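/- arXiv:2203.08712 — 8 statements merged into one kernel-verified Lean document; each statement's English description precedes it below -/
import Mathlib

section
/- Suppose S, Q ∈ ℝ^{n×n} are symmetric matrices with λ_{2m+1}(Q) = 0 for some integer m with 1 ≤ m ≤ n/4 − 1. Then for every p ∈ ℕ, tr((S+Q)^{2p+1}) − tr(S^{2p+1}) ≤ 2m·(λ_1(S+Q))^{2p+1} + (λ_n(S+Q))^{2p+1} + 3m·‖S‖^{2p+1}. -/
open Matrix

/-- The `k`-th largest eigenvalue (1-based) from an antitone enumeration `σ` of the
eigenvalues, with the convention that it is `0` for indices beyond `n`. -/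
def sortedEig {n : ℕ} (σ : Fin n → ℝ) (k : ℕ) : ℝ :=
  if h : k - 1 < n then σ ⟨k - 1, h⟩ else 0

/-- The quadratic form of an operator that is diagonal in an orthonormal basis. -/
theorem inner_map_self_eq_sum_of_orthonormal_eigenbasis {ι E : Type*} [Fintype ι]
    [NormedAddCommGroup E] [InnerProductSpace ℝ E] (b : OrthonormalBasis ι ℝ E)
    (T : E →ₗ[ℝ] E) (μ : ι → ℝ) (hT : ∀ i, T (b i) = μ i • b i) (x : E) :
    inner ℝ (T x) x = ∑ i, μ i * inner ℝ (b i) x ^ 2 := by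
  conv_lhs => rw [← b.sum_repr' x, map_sum, sum_inner, b.sum_repr' x]
  refine Finset.sum_congr rfl fun i _ => ?_
  rw [map_smul, hT, inner_smul_left, inner_smul_left]
  simp only [conj_trivial]
  ring

/-- Weyl's inequality for the eigenvalues of a sum of two operators, listed in decreasing order. -/
theorem eigenvalue_add_le {n : ℕ} {E : Type*} [NormedAddCommGroup E] [InnerProductSpace ℝ E]
    (u v w : OrthonormalBasis (Fin n) ℝ E) (S Q : E →ₗ[ℝ] E) (s q a : Fin n → ℝ)
    (hs : Antitone s) (hq : Antitone q) (ha : Antitone a)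
    (hS : ∀ i, S (u i) = s i • u i) (hQ : ∀ i, Q (v i) = q i • v i)
    (hA : ∀ i, (S + Q) (w i) = a i • w i)
    (i j k : Fin n) (hk : (k : ℕ) = i + j) : a k ≤ s i + q j := by
  have : FiniteDimensional ℝ E := u.toBasis.finiteDimensional_of_finite
  have hrank : Module.finrank ℝ E = n := by
    simpa using Module.finrank_eq_card_basis u.toBasis
  let c : {l // l < i} ⊕ {l // l < j} ⊕ {l // k < l} → E :=
    Sum.elim (fun l => u l) (Sum.elim (fun l => v l) (fun l => w l))
  let f : E →ₗ[ℝ] ({l // l < i} ⊕ {l // l < j} ⊕ {l // k < l} → ℝ) :=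
    LinearMap.pi fun l => innerₗ E (c l)
  have hker : LinearMap.ker f ≠ ⊥ := by
    apply LinearMap.ker_ne_bot_of_finrank_lt
    rw [hrank, Module.finrank_fintype_fun_eq_card]
    simp only [Fintype.card_sum, Fintype.card_subtype, Finset.filter_gt_eq_Iio,
      Finset.filter_lt_eq_Ioi, Fin.card_Iio, Fin.card_Ioi]
    omega
  obtain ⟨x, hx, hx0⟩ := Submodule.exists_mem_ne_zero_of_ne_bot hker
  have hzero (l) : inner ℝ (c l) x = 0 := congrFun (LinearMap.mem_ker.1 hx) l
  have hlow : a k * ‖x‖ ^ 2 ≤ inner ℝ ((S + Q) x) x := by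
    rw [inner_map_self_eq_sum_of_orthonormal_eigenbasis w _ a hA, ← w.sum_sq_inner_right x,
      Finset.mul_sum]
    refine Finset.sum_le_sum fun l _ => ?_
    rcases le_or_gt l k with h | h
    · exact mul_le_mul_of_nonneg_right (ha h) (sq_nonneg _)
    · have := hzero (.inr (.inr ⟨l, h⟩))
      simp_all [c]
  have hSup : inner ℝ (S x) x ≤ s i * ‖x‖ ^ 2 := by
    rw [inner_map_self_eq_sum_of_orthonormal_eigenbasis u _ s hS, ← u.sum_sq_inner_right x,
      Finset.mul_sum]
    refine Finset.sum_le_sum fun l _ => ?_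
    rcases le_or_gt i l with h | h
    · exact mul_le_mul_of_nonneg_right (hs h) (sq_nonneg _)
    · have := hzero (.inl ⟨l, h⟩)
      simp_all [c]
  have hQup : inner ℝ (Q x) x ≤ q j * ‖x‖ ^ 2 := by
    rw [inner_map_self_eq_sum_of_orthonormal_eigenbasis v _ q hQ, ← v.sum_sq_inner_right x,
      Finset.mul_sum]
    refine Finset.sum_le_sum fun l _ => ?_
    rcases le_or_gt j l with h | h
    · exact mul_le_mul_of_nonneg_right (hq h) (sq_nonneg _)
    · have := hzero (.inr (.inl ⟨l, h⟩))
      simp_all [c]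
  rw [LinearMap.add_apply, inner_add_left] at hlow
  refine le_of_mul_le_mul_right ?_ (pow_pos (norm_pos_iff.2 hx0) 2)
  linarith

/-- A real symmetric matrix acts diagonally on its reindexed eigenvector basis. -/
theorem Matrix.IsHermitian.toEuclideanLin_reindex_eigenvectorBasis {n : ℕ}
    {A : Matrix (Fin n) (Fin n) ℝ} (hA : A.IsHermitian) (e : Equiv.Perm (Fin n)) (i : Fin n) :
    toEuclideanLin A (hA.eigenvectorBasis.reindex e.symm i) =
      (hA.eigenvalues ∘ e) i • hA.eigenvectorBasis.reindex e.symm i := by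
  ext j
  simpa [toLpLin_apply] using congrFun (hA.mulVec_eigenvectorBasis (e i)) j

/-- The trace of a power of a real symmetric matrix is the power sum of its eigenvalues. -/
theorem Matrix.IsHermitian.trace_pow_eq_sum_eigenvalues {n : ℕ}
    {A : Matrix (Fin n) (Fin n) ℝ} (hA : A.IsHermitian) (k : ℕ) :
    (A ^ k).trace = ∑ i, hA.eigenvalues i ^ k := by
  conv_lhs => rw [hA.spectral_theorem, ← map_pow, Unitary.conjStarAlgAut_apply, trace_mul_cycle]
  simp [diagonal_pow, trace_diagonal]

theorem sortedEig_succ {n : ℕ} (σ : Fin n → ℝ) {k : ℕ} (hk : k < n) :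
    sortedEig σ (k + 1) = σ ⟨k, hk⟩ := by
  simp [sortedEig, hk]

/-- Comparing two sums whose terms satisfy a shifted inequality. -/
theorem sum_range_sub_sum_range_le_of_shift (a s : ℕ → ℝ) (d r : ℕ) (M N : ℝ)
    (ha : ∀ k < d, a k ≤ M) (has : ∀ k < r, a (d + k) ≤ s k)
    (hs : ∀ k < d + 1, -s (r + k) ≤ N) :
    ∑ k ∈ Finset.range (d + r + 1), a k - ∑ k ∈ Finset.range (d + r + 1), s k
      ≤ d * M + a (d + r) + (d + 1) * N := by
  have h1 : ∑ k ∈ Finset.range d, a k ≤ d * M := by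
    simpa using Finset.sum_le_card_nsmul (Finset.range d) a M (by simpa using ha)
  have h2 : ∑ k ∈ Finset.range r, a (d + k) ≤ ∑ k ∈ Finset.range r, s k :=
    Finset.sum_le_sum fun k hk => has k (Finset.mem_range.1 hk)
  have h3 : ∑ k ∈ Finset.range (d + 1), -s (r + k) ≤ (d + 1) * N := by
    simpa using Finset.sum_le_card_nsmul (Finset.range (d + 1)) (fun k => -s (r + k)) N
      (fun k hk => hs k (Finset.mem_range.1 hk))
  rw [Finset.sum_neg_distrib] at h3
  rw [Finset.sum_range_succ a, Finset.sum_range_add a, show d + r + 1 = r + (d + 1) by omega,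
    Finset.sum_range_add s]
  linarith

/-- if `S, Q` are symmetric and `λ_{2m+1}(Q) = 0` for some
`1 ≤ m ≤ n/4 − 1`, then for every `p`,
`tr((S+Q)^{2p+1}) − tr(S^{2p+1}) ≤ 2m·λ₁(S+Q)^{2p+1} + λ_n(S+Q)^{2p+1} + 3m·‖S‖^{2p+1}`. -/
theorem trace_difference_odd_power_bound
    {n : ℕ} (S Q : Matrix (Fin n) (Fin n) ℝ)
    (hS : S.IsHermitian) (hQ : Q.IsHermitian)
    (σS σQ σSQ : Fin n → ℝ)
    (hμS : Antitone σS) (hμQ : Antitone σQ) (hμSQ : Antitone σSQ)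
    (hES : ∃ e : Equiv.Perm (Fin n), σS = hS.eigenvalues ∘ e)
    (hEQ : ∃ e : Equiv.Perm (Fin n), σQ = hQ.eigenvalues ∘ e)
    (hESQ : ∃ e : Equiv.Perm (Fin n), σSQ = (hS.add hQ).eigenvalues ∘ e)
    (m : ℕ) (hm1 : 1 ≤ m) (hm2 : (m : ℝ) ≤ (n : ℝ) / 4 - 1)
    (hQzero : sortedEig σQ (2 * m + 1) = 0)
    (p : ℕ) :
    Matrix.trace ((S + Q) ^ (2 * p + 1)) - Matrix.trace (S ^ (2 * p + 1))
      ≤ 2 * (m : ℝ) * (sortedEig σSQ 1) ^ (2 * p + 1)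
        + (sortedEig σSQ n) ^ (2 * p + 1)
        + 3 * (m : ℝ) * (⨆ i, |σS i|) ^ (2 * p + 1) := by
  have hmn : 4 * m + 4 ≤ n := by
    have : (4 * m + 4 : ℝ) ≤ n := by linarith
    exact_mod_cast this
  have hodd : Odd (2 * p + 1) := odd_two_mul_add_one p
  have htrace {A : Matrix (Fin n) (Fin n) ℝ} (hA : A.IsHermitian) (σ : Fin n → ℝ)
      (hσ : ∃ e : Equiv.Perm (Fin n), σ = hA.eigenvalues ∘ e) :
      (A ^ (2 * p + 1)).trace = ∑ k ∈ Finset.range n, sortedEig σ (k + 1) ^ (2 * p + 1) := by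
    obtain ⟨e, rfl⟩ := hσ
    rw [hA.trace_pow_eq_sum_eigenvalues, Finset.sum_range,
      ← Equiv.sum_comp e fun i => hA.eigenvalues i ^ (2 * p + 1)]
    refine Finset.sum_congr rfl fun i _ => ?_
    rw [sortedEig_succ _ i.isLt]
    rfl
  have hweyl (k : ℕ) (hk : 2 * m + k < n) :
      sortedEig σSQ (2 * m + k + 1) ≤ sortedEig σS (k + 1) := by
    rw [sortedEig_succ _ (by omega)] at hQzero
    rw [sortedEig_succ _ hk, sortedEig_succ _ (by omega : k < n)]
    obtain ⟨e, he⟩ := hES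
    obtain ⟨f, hf⟩ := hEQ
    obtain ⟨g, hg⟩ := hESQ
    have h := eigenvalue_add_le (hS.eigenvectorBasis.reindex e.symm)
      (hQ.eigenvectorBasis.reindex f.symm) ((hS.add hQ).eigenvectorBasis.reindex g.symm)
      (toEuclideanLin S) (toEuclideanLin Q) σS σQ σSQ hμS hμQ hμSQ
      (he ▸ hS.toEuclideanLin_reindex_eigenvectorBasis e)
      (hf ▸ hQ.toEuclideanLin_reindex_eigenvectorBasis f)
      (by rw [← map_add]; exact hg ▸ (hS.add hQ).toEuclideanLin_reindex_eigenvectorBasis g)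
      ⟨k, by omega⟩ ⟨2 * m, by omega⟩ ⟨2 * m + k, hk⟩ (Nat.add_comm _ _)
    rwa [hQzero, add_zero] at h
  have hnorm (i : Fin n) : |σS i| ≤ ⨆ i, |σS i| :=
    le_ciSup (f := fun i => |σS i|) (Set.finite_range _).bddAbove i
  have hN : 0 ≤ (⨆ i, |σS i|) ^ (2 * p + 1) :=
    pow_nonneg (Real.iSup_nonneg fun i => abs_nonneg _) _
  obtain ⟨r, rfl⟩ : ∃ r, n = 2 * m + r + 1 := ⟨n - 2 * m - 1, by omega⟩
  have key := sum_range_sub_sum_range_le_of_shift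
    (fun k => sortedEig σSQ (k + 1) ^ (2 * p + 1)) (fun k => sortedEig σS (k + 1) ^ (2 * p + 1))
    (2 * m) r (sortedEig σSQ 1 ^ (2 * p + 1)) ((⨆ i, |σS i|) ^ (2 * p + 1))
    (fun k hk => hodd.strictMono_pow.monotone <| by
      rw [sortedEig_succ _ (by omega : k < 2 * m + r + 1),
        sortedEig_succ (k := 0) _ (by omega : 0 < 2 * m + r + 1)]
      exact hμSQ (Fin.mk_le_mk.2 (Nat.zero_le k)))
    (fun k hk => hodd.strictMono_pow.monotone (hweyl k (by omega)))
    (fun k hk => by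
      rw [← hodd.neg_pow]
      refine hodd.strictMono_pow.monotone ?_
      rw [sortedEig_succ _ (by omega : r + k < 2 * m + r + 1)]
      exact (neg_le_abs _).trans (hnorm _))
  rw [htrace (hS.add hQ) σSQ hESQ, htrace hS σS hES]
  have hm1' : (1 : ℝ) ≤ m := by exact_mod_cast hm1
  push_cast at key
  have := mul_le_mul_of_nonneg_right (by linarith : (2 * m + 1 : ℝ) ≤ 3 * m) hN
  linarith
end

section
/- Let n ∈ ℕ and let S be a set of pairs (i,j) with 1 ≤ i < j ≤ n such that any two distinct elements (i₁,j₁), (i₂,j₂) of S satisfy {i₁,j₁} ∩ {i₂,j₂} = ∅. Suppose a closed walk i = (i_0, i_1, …, i_{p'−1}, i_0) on {1,…,n} (of arbitrary length p' ≥ 1) contains at least one step not belonging to S, and some unordered edge of the walk appears an odd number of times among its steps. Then there exists an unordered edge of the walk not belonging to S that appears an odd number of times among the steps of the walk. -/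
/-- The unordered edge (encoded as an ordered pair `(min, max)`) traversed by the
`k`-th step of the walk `w`. -/
def wedge (w : ℕ → ℕ) (k : ℕ) : ℕ × ℕ := (min (w k) (w (k + 1)), max (w k) (w (k + 1)))

/-- The number of ends (`0`, `1` or `2`), modulo `2`, that an edge has at the vertex `a`. -/
def endsParity (a : ℕ) (q : ℕ × ℕ) : ZMod 2 :=
  (if q.1 = a then 1 else 0) + (if q.2 = a then 1 else 0)

lemma endsParity_wedge (a : ℕ) (w : ℕ → ℕ) (k : ℕ) :
    endsParity a (wedge w k) =
      (if w k = a then 1 else 0) + (if w (k + 1) = a then 1 else 0) := by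
  unfold endsParity wedge
  rcases le_total (w k) (w (k + 1)) with h | h
  · simp only [min_eq_left h, max_eq_right h]
  · simp only [min_eq_right h, max_eq_left h]
    exact add_comm _ _

/-- A closed walk has even degree at every vertex. -/
lemma sum_endsParity_wedge_eq_zero (a p : ℕ) (w : ℕ → ℕ) (hclosed : w p = w 0) :
    ∑ k ∈ Finset.range p, endsParity a (wedge w k) = 0 := by
  have hshift := Finset.sum_range_sub (fun k => if w k = a then (1 : ZMod 2) else 0) p
  simp only [hclosed, sub_self] at hshift
  rw [← hshift]
  refine Finset.sum_congr rfl fun k _ => ?_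
  rw [endsParity_wedge, CharTwo.sub_eq_add, add_comm]

/-- if a closed walk contains a step not belonging to `S` and some
unordered edge of the walk appears an odd number of times, then some unordered edge
not belonging to `S` appears an odd number of times. -/
theorem exists_odd_edge_not_in_S
    (S : Set (ℕ × ℕ))
    (hSlt : ∀ q ∈ S, q.1 < q.2)
    (hSdisj : ∀ q ∈ S, ∀ r ∈ S, q ≠ r → ({q.1, q.2} ∩ {r.1, r.2} : Set ℕ) = ∅)
    (p' : ℕ) (hp' : 1 ≤ p') (w : ℕ → ℕ) (hclosed : w p' = w 0)
    (hnotS : ∃ k ∈ Finset.range p', wedge w k ∉ S)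
    (hodd : ∃ k ∈ Finset.range p',
      Odd (((Finset.range p').filter fun k' => wedge w k' = wedge w k).card)) :
    ∃ k ∈ Finset.range p', wedge w k ∉ S ∧
      Odd (((Finset.range p').filter fun k' => wedge w k' = wedge w k).card) := by
  obtain ⟨k, hk, hkodd⟩ := hodd
  by_contra! hcon
  have hkS : wedge w k ∈ S := by
    by_contra h
    exact hcon k hk h hkodd
  have hzero := sum_endsParity_wedge_eq_zero (wedge w k).1 p' w hclosed
  rw [Finset.sum_comp (endsParity (wedge w k).1) (wedge w),
    Finset.sum_eq_single_of_mem (wedge w k) (Finset.mem_image_of_mem _ hk)] at hzero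
  · rw [nsmul_eq_mul, (ZMod.natCast_eq_one_iff_odd).2 hkodd, one_mul] at hzero
    simp [endsParity, (hSlt _ hkS).ne'] at hzero
  · intro q hq hne
    obtain ⟨j, hj, rfl⟩ := Finset.mem_image.1 hq
    by_cases hjS : wedge w j ∈ S
    · have hdisj := Set.eq_empty_iff_forall_notMem.1 (hSdisj _ hjS _ hkS hne) (wedge w k).1
      have h1 : (wedge w j).1 ≠ (wedge w k).1 := fun h => hdisj (by simp [h])
      have h2 : (wedge w j).2 ≠ (wedge w k).1 := fun h => hdisj (by simp [h])
      simp [endsParity, h1, h2]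
    · rw [nsmul_eq_mul, (ZMod.natCast_eq_zero_iff_even).2 (Nat.not_odd_iff_even.1 (hcon j hj hjS)),
        zero_mul]
end

section
/- Let i = (i_0, i_1, …, i_{2p−1}, i_0) be an even cycle of length 2p. If a vertex v belongs to N_i(k) for some k ≥ 1, then the number of unmarked steps of the form (v,u) (i.e., indices 0 ≤ j ≤ 2p−1 with i_j = v and the step (i_j, i_{j+1}) unmarked) is at most 2k; moreover, if k = 1, this number is at most 1. -/
/-- The `k`-th step of the walk `w` is marked if an even number of earlier steps
traverse the same unordered edge. -/
def marked (w : ℕ → ℕ) (k : ℕ) : Prop :=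
  Even (((Finset.range k).filter fun t => wedge w t = wedge w k).card)

open scoped Classical in
/-- `1` on marked steps and `-1` on unmarked steps. -/
noncomputable def markSign (w : ℕ → ℕ) (j : ℕ) : ℤ := if marked w j then 1 else -1

/-- The traversals of a given edge are alternately marked and unmarked. -/
theorem sum_markSign_edge (w : ℕ → ℕ) (e : ℕ × ℕ) (n : ℕ) :
    (∑ j ∈ (Finset.range n).filter fun t => wedge w t = e, markSign w j) =
      if Even (((Finset.range n).filter fun t => wedge w t = e).card) then 0 else 1 := by
  induction n with
  | zero => simp
  | succ n ih =>
    rw [Finset.range_add_one, Finset.filter_insert]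
    by_cases h : wedge w n = e
    · have hn : n ∉ (Finset.range n).filter fun t => wedge w t = e := by simp
      rw [if_pos h, Finset.sum_insert hn, Finset.card_insert_of_notMem hn, ih]
      subst h
      by_cases hm : Even (((Finset.range n).filter fun t => wedge w t = wedge w n).card) <;>
        simp [markSign, marked, hm, Nat.even_add_one]
    · rw [if_neg h, ih]

/-- In an even cycle, the signs of the steps cancel against any weight depending only on the
edge. -/
theorem sum_markSign_mul_weight (w : ℕ → ℕ) (n : ℕ)
    (heven : ∀ k ∈ Finset.range n,
      Even (((Finset.range n).filter fun t => wedge w t = wedge w k).card))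
    (g : ℕ × ℕ → ℤ) : ∑ j ∈ Finset.range n, markSign w j * g (wedge w j) = 0 := by
  rw [← Finset.sum_fiberwise_of_maps_to
    (fun j hj => Finset.mem_image_of_mem (wedge w) hj)]
  refine Finset.sum_eq_zero fun e he => ?_
  obtain ⟨k, hk, rfl⟩ := Finset.mem_image.mp he
  have hg : ∀ j ∈ (Finset.range n).filter fun t => wedge w t = wedge w k,
      markSign w j * g (wedge w j) = markSign w j * g (wedge w k) := fun j hj => by
    rw [(Finset.mem_filter.mp hj).2]
  rw [Finset.sum_congr rfl hg, ← Finset.sum_mul, sum_markSign_edge, if_pos (heven k hk), zero_mul]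

/-- The number of endpoints of the `j`-th step equal to `v` depends only on its edge. -/
theorem wedge_incidence (w : ℕ → ℕ) (v j : ℕ) :
    ((if (wedge w j).1 = v then 1 else 0) + (if (wedge w j).2 = v then 1 else 0) : ℤ) =
      (if w j = v then 1 else 0) + (if w (j + 1) = v then 1 else 0) := by
  rcases le_total (w j) (w (j + 1)) with h | h
  · simp [wedge, h]
  · simp [wedge, h, add_comm]

open scoped Classical in
/-- In an even cycle, the number of unmarked steps out of `v` equals the number of marked steps
into `v`. -/
theorem card_unmarked_out_eq_card_marked_in (n : ℕ) (w : ℕ → ℕ) (hclosed : w n = w 0)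
    (heven : ∀ k ∈ Finset.range n,
      Even (((Finset.range n).filter fun t => wedge w t = wedge w k).card)) (v : ℕ) :
    ((Finset.range n).filter fun j => w j = v ∧ ¬ marked w j).card =
      ((Finset.range n).filter fun j => marked w j ∧ w (j + 1) = v).card := by
  have hsign := sum_markSign_mul_weight w n heven
    fun e => (if e.1 = v then 1 else 0) + (if e.2 = v then 1 else 0)
  simp only [wedge_incidence] at hsign
  have hflow := Finset.sum_range_sub (fun j => if w j = v then (1 : ℤ) else 0) n
  rw [hclosed, sub_self] at hflow
  have hsum : (∑ j ∈ Finset.range n,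
      (2 * (if marked w j ∧ w (j + 1) = v then (1 : ℤ) else 0) -
        2 * (if w j = v ∧ ¬ marked w j then (1 : ℤ) else 0))) = 0 := by
    have h := congrArg₂ (· + ·) hsign hflow
    simp only [← Finset.sum_add_distrib, add_zero] at h
    refine Eq.trans ?_ h
    refine Finset.sum_congr rfl fun j _ => ?_
    by_cases hm : marked w j <;> by_cases h₀ : w j = v <;> by_cases h₁ : w (j + 1) = v <;>
      simp [markSign, hm, h₀, h₁]
  rw [Finset.sum_sub_distrib, ← Finset.mul_sum, ← Finset.mul_sum, Finset.sum_boole,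
    Finset.sum_boole] at hsum
  omega

open scoped Classical in
/-- in an even cycle of length `2p`, a vertex `v` marked exactly `k ≥ 1`
times is the left endpoint of at most `2k` unmarked steps, and of at most one if
`k = 1`. -/
theorem unmarked_steps_bound
    (p : ℕ) (hp : 1 ≤ p) (w : ℕ → ℕ) (hclosed : w (2 * p) = w 0)
    (heven : ∀ k ∈ Finset.range (2 * p),
      Even (((Finset.range (2 * p)).filter fun t => wedge w t = wedge w k).card))
    (v : ℕ) (k : ℕ) (hk : 1 ≤ k)
    (hmarkCount :
      (((Finset.range (2 * p)).filter fun j => marked w j ∧ w (j + 1) = v).card) = k) :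
    (((Finset.range (2 * p)).filter fun j => w j = v ∧ ¬ marked w j).card) ≤ 2 * k ∧
      (k = 1 →
        (((Finset.range (2 * p)).filter fun j => w j = v ∧ ¬ marked w j).card) ≤ 1) := by
  rw [card_unmarked_out_eq_card_marked_in (2 * p) w hclosed heven v, hmarkCount]
  omega
end

section
/- For all integers l ≥ 1 and t with 2 ≤ t ≤ l+1, f_{l,t} ≤ b_{l,t} ≤ (l+1)^{120}·f_{l,t}. -/
/-- `w` encodes an element of `C(l)`: a closed walk `(w 0, …, w (2l))` with vertices
in `ℕ`, `w (2l) = w 0`, written in canonical form (`w 0 = 0`, and each newly appearing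
vertex is the smallest natural number not yet used, i.e. every value is at most one
more than the maximum of the earlier values), constantly `0` after time `2l`, and such
that every unordered edge occurs exactly twice among the `2l` steps. -/
def IsCanonicalPairWalk (l : ℕ) (w : ℕ → ℕ) : Prop :=
  w 0 = 0 ∧ w (2 * l) = w 0 ∧
  (∀ j, 1 ≤ j → j ≤ 2 * l → w j ≤ ((Finset.range j).sup w) + 1) ∧
  (∀ j, 2 * l < j → w j = 0) ∧
  (∀ k ∈ Finset.range (2 * l),
    ((Finset.range (2 * l)).filter fun t => wedge w t = wedge w k).card = 2)

/-- The multiplicity of the vertex `v` in the walk `(w 0, …, w (2l))`: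
the number of indices `0 ≤ j ≤ 2l` with `w j = v`. -/
def multIn (l : ℕ) (w : ℕ → ℕ) (v : ℕ) : ℕ :=
  ((Finset.range (2 * l + 1)).filter fun j => w j = v).card

/-- `f_{l,t}`: the number of walks in `C(l)` whose first vertex has multiplicity `t`. -/
noncomputable def fCount (l t : ℕ) : ℕ :=
  Nat.card {w : ℕ → ℕ // IsCanonicalPairWalk l w ∧ multIn l w (w 0) = t}

/-- `s_{l,t}`: the number of walks in `C(l)` whose second vertex has multiplicity `t`. -/
noncomputable def sCount (l t : ℕ) : ℕ :=
  Nat.card {w : ℕ → ℕ // IsCanonicalPairWalk l w ∧ multIn l w (w 1) = t}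

/-- `b_{l,t} = Σ_{w ∈ C(l)} #{vertices of `w` of multiplicity `t`}`, counted as the
number of pairs `(w, v)` with `w ∈ C(l)` and `v` a vertex of multiplicity `t` in `w`. -/
noncomputable def bCount (l t : ℕ) : ℕ :=
  Nat.card {q : (ℕ → ℕ) × ℕ // IsCanonicalPairWalk l q.1 ∧ multIn l q.1 q.2 = t}

/-- The multiset of unordered edges traversed by a walk given as a list of vertices. -/
def edges : List ℕ → Multiset (Sym2 ℕ)
  | [] => 0
  | [_] => 0
  | a :: b :: L => s(a, b) ::ₘ edges (b :: L)

@[simp] lemma edges_singleton (a : ℕ) : edges [a] = 0 := rfl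

@[simp] lemma edges_cons_cons (a b : ℕ) (L : List ℕ) :
    edges (a :: b :: L) = s(a, b) ::ₘ edges (b :: L) := rfl

lemma edges_append_cons (P : List ℕ) (c : ℕ) (Q : List ℕ) :
    edges (P ++ c :: Q) = edges (P ++ [c]) + edges (c :: Q) := by
  induction P with
  | nil => simp
  | cons a P ih =>
    cases P with
    | nil => simp
    | cons b P => simpa using ih

lemma edges_reverse (L : List ℕ) : edges L.reverse = edges L := by
  induction L with
  | nil => rfl
  | cons a L ih =>
    cases L with
    | nil => rfl
    | cons b L =>
      have h : (a :: b :: L).reverse = L.reverse ++ b :: [a] := by simp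
      rw [h, edges_append_cons, edges_cons_cons, edges_cons_cons, ← ih, List.reverse_cons,
        Sym2.eq_swap]
      simp [← Multiset.singleton_add, add_comm]

lemma mem_of_mem_edges {L : List ℕ} {a b : ℕ} (h : s(a, b) ∈ edges L) : a ∈ L ∧ b ∈ L := by
  induction L with
  | nil => simp [edges] at h
  | cons c L ih =>
    cases L with
    | nil => simp at h
    | cons d L =>
      rw [edges_cons_cons, Multiset.mem_cons, Sym2.eq_iff] at h
      rcases h with (⟨rfl, rfl⟩ | ⟨rfl, rfl⟩) | h
      · simp
      · simp
      · exact ⟨List.mem_cons_of_mem _ (ih h).1, List.mem_cons_of_mem _ (ih h).2⟩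

lemma exists_eq_append_of_mem_edges {L : List ℕ} {e : Sym2 ℕ} (h : e ∈ edges L) :
    ∃ P a b Q, L = P ++ a :: b :: Q ∧ e = s(a, b) := by
  induction L with
  | nil => simp [edges] at h
  | cons c L ih =>
    cases L with
    | nil => simp at h
    | cons d L =>
      rw [edges_cons_cons, Multiset.mem_cons] at h
      rcases h with h | h
      · exact ⟨[], c, d, L, rfl, h⟩
      · obtain ⟨P, a, b, Q, h1, h2⟩ := ih h
        exact ⟨c :: P, a, b, Q, by simp [h1], h2⟩

/-- Every edge of the walk is traversed exactly twice. -/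
def IsPaired (L : List ℕ) : Prop := ∀ e ∈ edges L, (edges L).count e = 2

lemma IsPaired.exchange {L u : List ℕ} {e e' : Sym2 ℕ} {X : Multiset (Sym2 ℕ)}
    (hL : IsPaired L) (h : edges L = e ::ₘ e ::ₘ X) (h' : edges u = e' ::ₘ e' ::ₘ X)
    (he' : e' ∉ X) : IsPaired u := by
  have he : e ∉ X := by
    have := hL e (by simp [h])
    rw [h, Multiset.count_cons_self, Multiset.count_cons_self] at this
    exact Multiset.count_eq_zero.1 (by omega)
  intro f hf
  rw [h'] at hf ⊢
  by_cases hfe : f = e'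
  · subst hfe
    simp [Multiset.count_eq_zero.2 he']
  · have hfX : f ∈ X := by simpa [hfe] using hf
    have hne : f ≠ e := fun hh => he (hh ▸ hfX)
    have := hL f (by simp [h, hfX])
    rw [h, Multiset.count_cons_of_ne hne, Multiset.count_cons_of_ne hne] at this
    rw [Multiset.count_cons_of_ne hfe, Multiset.count_cons_of_ne hfe, this]

/-- Repeat the entry at position `p`. -/
def stutter (p : ℕ) (L : List ℕ) : List ℕ := L.take (p + 1) ++ L.drop p

/-- Undo one of the surgeries (selected by `k`) that lower the multiplicity of the base point;
the parameters are the positions at which the surgery took place. -/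
def undoSurgery (k a b d : ℕ) (u : List ℕ) : List ℕ :=
  match k with
  | 0 => stutter b (stutter a (u.drop 2))
  | 1 => u.take 1 ++ u.drop (a + 2) ++ (u.take (a + 1)).reverse
  | 2 => u.take 1 ++ (u.drop 2).take (a + 1) ++ u.take 1 ++ u.drop (a + 3)
  | _ => u.take 1 ++ (u.drop (a + b + 2)).take d ++ (u.drop a).take (b + 1) ++ u.take a ++
      u.drop (a + b + 2 + d)

/-- Undo the rotation of a closed walk which moves the last `q + 1` entries to the front. -/
def undoRotation (q : ℕ) (u : List ℕ) : List ℕ :=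
  (u.drop q).take 1 ++ u.drop (q + 1) ++ (u.drop 1).take q

lemma undoSurgery_map (k a b d : ℕ) (φ : ℕ → ℕ) (u : List ℕ) :
    undoSurgery k a b d (u.map φ) = (undoSurgery k a b d u).map φ := by
  unfold undoSurgery
  split <;> simp [stutter, List.map_take, List.map_drop]

lemma undoRotation_map (q : ℕ) (φ : ℕ → ℕ) (u : List ℕ) :
    undoRotation q (u.map φ) = (undoRotation q u).map φ := by
  simp [undoRotation, List.map_take, List.map_drop]

lemma mem_of_mem_undoSurgery {k a b d x : ℕ} {u : List ℕ} (h : x ∈ undoSurgery k a b d u) :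
    x ∈ u := by
  unfold undoSurgery at h
  split at h <;> simp only [stutter, List.mem_append, List.mem_reverse] at h
  · rcases h with h | h
    · rcases List.mem_append.1 (List.mem_of_mem_take h) with h | h
      · exact List.mem_of_mem_drop (List.mem_of_mem_take h)
      · exact List.mem_of_mem_drop (List.mem_of_mem_drop h)
    · rcases List.mem_append.1 (List.mem_of_mem_drop h) with h | h
      · exact List.mem_of_mem_drop (List.mem_of_mem_take h)
      · exact List.mem_of_mem_drop (List.mem_of_mem_drop h)
  all_goals grind [List.mem_of_mem_take, List.mem_of_mem_drop]

lemma mem_of_mem_undoRotation {q x : ℕ} {u : List ℕ} (h : x ∈ undoRotation q u) : x ∈ u := by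
  simp only [undoRotation, List.mem_append] at h
  grind [List.mem_of_mem_take, List.mem_of_mem_drop]

/-- A closed walk from `v` to `v` traversing each of its edges exactly twice. -/
structure IsPairedLoop (v : ℕ) (L : List ℕ) : Prop where
  head : L.head? = some v
  last : L.getLast? = some v
  paired : IsPaired L

lemma stutter_append (P Q : List ℕ) (v : ℕ) :
    stutter P.length (P ++ v :: Q) = P ++ v :: v :: Q := by
  simp [stutter, List.take_append]

lemma edges_repeat (P Q : List ℕ) (v : ℕ) :
    edges (P ++ v :: v :: Q) = s(v, v) ::ₘ edges (P ++ v :: Q) := by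
  rw [edges_append_cons, edges_append_cons P v Q]
  simp

lemma head?_repeat (P Q : List ℕ) (v : ℕ) :
    (P ++ v :: v :: Q).head? = (P ++ v :: Q).head? := by
  cases P <;> simp

lemma getLast?_repeat (P Q : List ℕ) (v : ℕ) :
    (P ++ v :: v :: Q).getLast? = (P ++ v :: Q).getLast? := by
  simp [List.getLast?_append, List.getLast?_cons_cons]

lemma exists_notMem (L : List ℕ) : ∃ z, z ∉ L := by
  obtain ⟨z, hz⟩ := Infinite.exists_notMem_finset L.toFinset
  exact ⟨z, by simpa using hz⟩

/-- A closed paired walk whose base point has multiplicity `t + 1 ≥ 3` can be obtained, by undoing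
a surgery, from one whose base point has multiplicity `t`. -/
def IsReducible (v t : ℕ) (L : List ℕ) : Prop :=
  ∃ u k a b d, IsPairedLoop v u ∧ u.length = L.length ∧ u.count v = t ∧
    undoSurgery k a b d u = L ∧ k < 4 ∧ a ≤ L.length ∧ b ≤ L.length ∧ d ≤ L.length

lemma IsPairedLoop.isReducible_of_loop {v t : ℕ} {L : List ℕ} (h : IsPairedLoop v L)
    (hc : L.count v = t + 1) (hv : s(v, v) ∈ edges L) : IsReducible v t L := by
  obtain ⟨z, hz⟩ := exists_notMem L
  have hc2 := h.paired _ hv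
  obtain ⟨P, a, b, Q, rfl, hab⟩ := exists_eq_append_of_mem_edges hv
  obtain ⟨rfl, rfl⟩ : v = a ∧ v = b := by rw [Sym2.eq_iff] at hab; tauto
  rw [edges_repeat, Multiset.count_cons_self] at hc2
  obtain ⟨P', a, b, Q', h1, hab⟩ := exists_eq_append_of_mem_edges
    (L := P ++ v :: Q) (e := s(v, v)) (Multiset.count_pos.1 (by omega))
  obtain ⟨rfl, rfl⟩ : v = a ∧ v = b := by rw [Sym2.eq_iff] at hab; tauto
  have hE : edges (P ++ v :: v :: Q) = s(v, v) ::ₘ s(v, v) ::ₘ edges (P' ++ v :: Q') := by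
    rw [edges_repeat, h1, edges_repeat]
  have hhead := h.head
  have hlast := h.last
  rw [head?_repeat, h1, head?_repeat] at hhead
  rw [getLast?_repeat, h1, getLast?_repeat] at hlast
  have hlen := congrArg List.length h1
  have hcnt := congrArg (List.count v) h1
  have hmem : ∀ x, x ∈ P ++ v :: Q ↔ x ∈ P' ++ v :: v :: Q' := fun x => by rw [h1]
  have hz' : z ∉ P' ++ v :: Q' := by
    have := hmem z
    simp at this hz ⊢
    tauto
  have hzv : z ≠ v := by rintro rfl; simp at hz
  simp at hlen
  simp at hcnt hc
  refine ⟨v :: z :: (P' ++ v :: Q'), 0, P'.length, P.length, 0, ⟨by simp, ?_, ?_⟩, ?_, ?_, ?_,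
    by omega, ?_, ?_, by omega⟩
  · rw [List.getLast?_cons_cons]
    obtain ⟨T, hT⟩ := List.head?_eq_some_iff.1 hhead
    rw [hT] at hlast ⊢
    simpa [List.getLast?_cons_cons] using hlast
  · refine h.paired.exchange (e' := s(v, z)) hE ?_ ?_
    · obtain ⟨T, hT⟩ := List.head?_eq_some_iff.1 hhead
      rw [hT, edges_cons_cons, edges_cons_cons, Sym2.eq_swap (a := z)]
    · exact fun hm => hz' (mem_of_mem_edges hm).2
  · simp; omega
  · simp [hzv]; omega
  · change stutter _ (stutter _ (P' ++ v :: Q')) = _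
    rw [stutter_append, ← h1, stutter_append]
  · simp; omega
  · simp

lemma IsPairedLoop.isReducible_same {v t x : ℕ} {P R : List ℕ} (hx : x ≠ v)
    (hP : P.head? = some x)
    (h : IsPairedLoop v (v :: (P ++ v :: x :: R)))
    (hc : (v :: (P ++ v :: x :: R)).count v = t + 1) :
    IsReducible v t (v :: (P ++ v :: x :: R)) := by
  obtain ⟨z, hz⟩ := exists_notMem (v :: (P ++ v :: x :: R))
  obtain ⟨P', rfl⟩ := List.head?_eq_some_iff.1 hP
  have hlast := h.last
  have hR : R.getLast? = some v := by
    cases R with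
    | nil => simp [List.getLast?_append, List.getLast?_cons] at hlast; exact absurd hlast hx
    | cons b R =>
      rw [← hlast]
      simp [List.getLast?_append, List.getLast?_cons]
  simp at hz
  refine ⟨R.reverse ++ x :: z :: (x :: P' ++ [v]), 1, R.length, 0, 0, ⟨?_, ?_, ?_⟩, ?_, ?_, ?_,
    by omega, ?_, by omega, by omega⟩
  · simp [hR]
  · simp [List.getLast?_append, List.getLast?_cons]
  · refine h.paired.exchange (e := s(v, x)) (e' := s(x, z))
      (X := edges (x :: P' ++ [v]) + edges (x :: R)) ?_ ?_ ?_
    · rw [List.cons_append, edges_cons_cons, ← List.cons_append, edges_append_cons,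
        edges_cons_cons]
      simp
    · rw [edges_append_cons, ← List.reverse_cons, edges_reverse]
      simp only [List.cons_append, edges_cons_cons, Sym2.eq_swap (a := z)]
      simp [add_comm]
    · intro hm
      rcases Multiset.mem_add.1 hm with hm | hm
      · have := (mem_of_mem_edges hm).2
        simp at this; tauto
      · have := (mem_of_mem_edges hm).2
        simp at this; tauto
  · simp; omega
  · simp [hx] at hc ⊢
    grind
  · simp only [undoSurgery]
    obtain ⟨T, hT⟩ := List.head?_eq_some_iff.1
      (show (R.reverse).head? = some v by simp [hR])
    have h1 : (R.reverse ++ x :: z :: (x :: P' ++ [v])).take 1 = [v] := by rw [hT]; simp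
    rw [h1]
    simp [List.take_append, List.drop_append, List.take_of_length_le]
  · simp; omega

lemma IsPairedLoop.isReducible_shared {v t x c : ℕ} {A R : List ℕ} (hx : x ≠ v)
    (hA : A.head? = some x) (hA' : A.getLast? = some x)
    (hcA : c ∈ A) (hcR : c ∈ v :: R)
    (h : IsPairedLoop v (v :: (A ++ v :: R)))
    (hc : (v :: (A ++ v :: R)).count v = t + 1) :
    IsReducible v t (v :: (A ++ v :: R)) := by
  obtain ⟨z, hz⟩ := exists_notMem (v :: (A ++ v :: R))
  have hE : edges (v :: (A ++ v :: R)) = s(v, x) ::ₘ s(v, x) ::ₘ (edges A + edges (v :: R)) := by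
    obtain ⟨A', rfl⟩ := List.head?_eq_some_iff.1 hA
    obtain ⟨A'', hA''⟩ := List.getLast?_eq_some_iff.1 hA'
    rw [List.cons_append, edges_cons_cons, ← List.cons_append, hA'', List.append_assoc,
      List.singleton_append, edges_append_cons, edges_cons_cons, Sym2.eq_swap (a := x)]
    simp
  obtain ⟨A1, A2, rfl⟩ := List.append_of_mem hcA
  obtain ⟨B1, B2, hB⟩ := List.append_of_mem hcR
  have hhead : (B1 ++ c :: B2).head? = some v := by rw [← hB]; rfl
  have hlast : (B1 ++ c :: B2).getLast? = some v := by
    rw [← hB, ← h.last]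
    simp [List.getLast?_append, List.getLast?_cons]
  have hlen := congrArg List.length hB
  have hcnt := congrArg (List.count v) hB
  rw [hB] at hz hE hc ⊢
  have hEu : edges (B1 ++ c :: A2 ++ z :: (A1 ++ c :: B2)) =
      s(x, z) ::ₘ s(x, z) ::ₘ (edges (A1 ++ c :: A2) + edges (B1 ++ c :: B2)) := by
    have e1 : edges (c :: A2 ++ z :: (A1 ++ c :: B2)) =
        edges (c :: A2) + s(x, z) ::ₘ edges (z :: (A1 ++ c :: B2)) := by
      obtain ⟨T, hT⟩ := List.getLast?_eq_some_iff.1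
        (show (c :: A2).getLast? = some x by simpa [List.getLast?_append] using hA')
      rw [hT, List.append_assoc, List.singleton_append, edges_append_cons, edges_cons_cons]
    have e2 : edges (z :: (A1 ++ c :: B2)) = s(x, z) ::ₘ edges (A1 ++ c :: B2) := by
      obtain ⟨T, hT⟩ := List.head?_eq_some_iff.1
        (show (A1 ++ c :: B2).head? = some x by cases A1 <;> simpa using hA)
      rw [hT, edges_cons_cons, Sym2.eq_swap]
    rw [List.append_assoc, List.cons_append, edges_append_cons, ← List.cons_append, e1, e2,
      edges_append_cons A1 c B2, edges_append_cons A1 c A2, edges_append_cons B1 c B2]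
    simp only [← Multiset.singleton_add]
    abel
  refine ⟨B1 ++ c :: A2 ++ z :: (A1 ++ c :: B2), 3, B1.length, A2.length, A1.length,
    ⟨?_, ?_, ?_⟩, ?_, ?_, ?_, by omega, ?_, ?_, ?_⟩
  · rw [← hhead]; cases B1 <;> simp
  · rw [← hlast]
    simp [List.getLast?_append, List.getLast?_cons]
  · refine h.paired.exchange (e := s(v, x)) (by rw [hB]; exact hE) hEu ?_
    intro hm
    apply hz
    rcases Multiset.mem_add.1 hm with hm | hm
    · have := (mem_of_mem_edges hm).2
      simp at this ⊢; tauto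
    · have := (mem_of_mem_edges hm).2
      simp at this ⊢; tauto
  · simp; omega
  · have hzv : z ≠ v := by rintro rfl; simp at hz
    simp [List.count_cons, hzv] at hc hcnt ⊢
    omega
  · simp only [undoSurgery]
    obtain ⟨T, hT⟩ := List.head?_eq_some_iff.1
      (show (B1 ++ c :: A2 ++ z :: (A1 ++ c :: B2)).head? = some v by
        rw [← hhead]; cases B1 <;> simp)
    have h1 : (B1 ++ c :: A2 ++ z :: (A1 ++ c :: B2)).take 1 = [v] := by rw [hT]; simp
    have h2 : (B1 ++ c :: A2 ++ z :: (A1 ++ c :: B2)).drop (B1.length + A2.length + 2) =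
        A1 ++ c :: B2 := by
      have : B1 ++ c :: A2 ++ z :: (A1 ++ c :: B2) =
        (B1 ++ c :: A2 ++ [z]) ++ (A1 ++ c :: B2) := by simp
      rw [this]
      exact List.drop_left' (by simp; omega)
    rw [h1, h2, ← List.drop_drop, h2]
    simp
  all_goals (simp; try omega)

lemma IsPairedLoop.isReducible_disjoint {v t x b : ℕ} {P R : List ℕ}
    (hA : (P ++ [x]).head? = some x) (hb : b ≠ v)
    (hd : ∀ c ∈ P ++ [x], c ∉ v :: b :: R)
    (h : IsPairedLoop v (v :: (P ++ x :: v :: b :: R)))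
    (hc : (v :: (P ++ x :: v :: b :: R)).count v = t + 1) :
    IsReducible v t (v :: (P ++ x :: v :: b :: R)) := by
  have hxn := hd x (by simp)
  have hvn : v ∉ P := fun hv => hd v (by simp [hv]) (by simp)
  simp at hxn
  have hlast := h.last
  refine ⟨v :: b :: (P ++ x :: b :: R), 2, P.length, 0, 0,
    ⟨by simp, ?_, ?_⟩, ?_, ?_, ?_, by omega, ?_, by omega, by omega⟩
  · rw [← hlast]; simp [List.getLast?_append, List.getLast?_cons]
  · have key : ∀ y S, edges (y :: (P ++ x :: S)) =
        s(y, x) ::ₘ (edges (P ++ [x]) + edges (x :: S)) := by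
      intro y S
      rw [← edges_append_cons]
      obtain ⟨T, hT⟩ := List.head?_eq_some_iff.1
        (show (P ++ x :: S).head? = some x by cases P <;> simpa using hA)
      rw [hT, edges_cons_cons]
    refine h.paired.exchange (e := s(v, x)) (e' := s(b, x))
      (X := s(v, b) ::ₘ (edges (P ++ [x]) + edges (b :: R))) ?_ ?_ ?_
    · rw [key, edges_cons_cons, edges_cons_cons, Sym2.eq_swap (a := x)]
      simp only [← Multiset.singleton_add]
      abel
    · rw [edges_cons_cons, key, edges_cons_cons, Sym2.eq_swap (a := x)]
      simp only [← Multiset.singleton_add]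
      abel
    · intro hm
      rcases Multiset.mem_cons.1 hm with hm | hm
      · rw [Sym2.eq_iff] at hm
        tauto
      rcases Multiset.mem_add.1 hm with hm | hm
      · exact hd b (mem_of_mem_edges hm).1 (by simp)
      · have := (mem_of_mem_edges hm).2
        simp at this; tauto
  · simp; omega
  · simp [List.count_eq_zero.2 hvn, hb, hxn] at hc ⊢
    omega
  · simp [undoSurgery, List.take_append, List.drop_append, List.take_of_length_le]
  · simp; omega

lemma IsPairedLoop.isReducible {v t : ℕ} {L : List ℕ} (ht : 2 ≤ t) (h : IsPairedLoop v L)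
    (hc : L.count v = t + 1) : IsReducible v t L := by
  by_cases hv : s(v, v) ∈ edges L
  · exact h.isReducible_of_loop hc hv
  obtain ⟨S, rfl⟩ := List.head?_eq_some_iff.1 h.head
  cases S with
  | nil => simp at hc; omega
  | cons x S =>
    have hx : x ≠ v := by rintro rfl; simp at hv
    have h2 := h.paired s(v, x) (by simp)
    rw [edges_cons_cons, Multiset.count_cons_self] at h2
    obtain ⟨P, a, b, R, h1, hab⟩ := exists_eq_append_of_mem_edges
      (L := x :: S) (e := s(v, x)) (Multiset.count_pos.1 (by omega))
    have hhead : (P ++ a :: b :: R).head? = some x := by rw [← h1]; rfl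
    rw [h1] at h hc hv ⊢
    rcases Sym2.eq_iff.1 hab with ⟨rfl, rfl⟩ | ⟨rfl, rfl⟩
    · refine h.isReducible_same hx ?_ hc
      cases P with
      | nil => simp at hhead; exact absurd hhead.symm hx
      | cons y P => simpa using hhead
    · have hA : (P ++ [x]).head? = some x := by cases P <;> simpa using hhead
      have eq : P ++ x :: v :: R = (P ++ [x]) ++ v :: R := by simp
      by_cases hs : ∃ c ∈ P ++ [x], c ∈ v :: R
      · obtain ⟨c, hcA, hcR⟩ := hs
        rw [eq] at h hc ⊢
        exact h.isReducible_shared hx hA (by simp) hcA hcR hc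
      · push Not at hs
        cases R with
        | nil =>
          have hvP : v ∉ P := fun hvP => hs v (by simp [hvP]) (by simp)
          simp [List.count_eq_zero.2 hvP, hx] at hc
          omega
        | cons b R =>
          have hb : b ≠ v := by
            rintro rfl
            apply hv
            rw [← List.cons_append, edges_append_cons]
            simp
          exact h.isReducible_disjoint hA hb hs hc

lemma IsPairedLoop.exists_rotation {v c : ℕ} {P Q : List ℕ} (hc : c ≠ v)
    (h : IsPairedLoop v (P ++ c :: Q)) :
    ∃ u, IsPairedLoop c u ∧ u.length = (P ++ c :: Q).length ∧
      u.count c = (P ++ c :: Q).count c + 1 ∧ undoRotation Q.length u = P ++ c :: Q := by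
  obtain ⟨hh, hl, hp⟩ := h
  cases P with
  | nil => simp at hh; exact absurd hh hc
  | cons y P =>
  obtain rfl : y = v := by simpa using hh
  cases hQ : Q.reverse with
  | nil =>
    obtain rfl : Q = [] := by simpa using hQ
    simp [List.getLast?_append, List.getLast?_cons] at hl
    exact absurd hl hc
  | cons y' T =>
  obtain rfl : Q = T.reverse ++ [y'] := by
    rw [← List.reverse_cons, ← hQ, List.reverse_reverse]
  obtain rfl : y' = y := by simpa [List.getLast?_append, List.getLast?_cons] using hl
  refine ⟨c :: T.reverse ++ y' :: (P ++ [c]), ⟨by simp, ?_, ?_⟩, ?_, ?_, ?_⟩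
  · simp [List.getLast?_append, List.getLast?_cons]
  · have : edges (c :: T.reverse ++ y' :: (P ++ [c])) =
        edges (y' :: P ++ c :: (T.reverse ++ [y'])) := by
      rw [edges_append_cons, edges_append_cons (y' :: P) c, add_comm]
      simp
    intro e he
    rw [this] at he ⊢
    exact hp e he
  · simp; omega
  · simp [hc.symm]; omega
  · simp [undoRotation, List.take_append, List.drop_append, List.take_of_length_le]

/-- The list of vertices `w 0, …, w (2l)`. -/
def vertexList (l : ℕ) (w : ℕ → ℕ) : List ℕ := (List.range (2 * l + 1)).map w

lemma length_vertexList (l : ℕ) (w : ℕ → ℕ) : (vertexList l w).length = 2 * l + 1 := by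
  simp [vertexList]

lemma multIn_eq_count (l : ℕ) (w : ℕ → ℕ) (v : ℕ) : multIn l w v = (vertexList l w).count v := by
  have : ∀ n, ((Finset.range n).filter fun j => w j = v).card =
      ((List.range n).map w).count v := by
    intro n
    induction n with
    | zero => simp
    | succ n ih =>
      rw [Finset.range_add_one, Finset.filter_insert, List.range_succ, List.map_append,
        List.count_append, ← ih]
      by_cases h : w n = v <;> simp [h]
  exact this _

lemma edges_map_range (w : ℕ → ℕ) (n : ℕ) :
    edges ((List.range (n + 1)).map w) =
      (Multiset.range n).map fun k => s(w k, w (k + 1)) := by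
  induction n with
  | zero => simp
  | succ n ih =>
    have h : (List.range (n + 1 + 1)).map w = (List.range n).map w ++ w n :: [w (n + 1)] := by
      simp [List.range_succ]
    rw [h, edges_append_cons, Multiset.range_succ, Multiset.map_cons, ← ih]
    simp [List.range_succ, ← Multiset.singleton_add, add_comm]

lemma wedge_eq_iff (w : ℕ → ℕ) (i j : ℕ) :
    wedge w i = wedge w j ↔ s(w j, w (j + 1)) = s(w i, w (i + 1)) := by
  rw [Sym2.eq_iff, wedge, wedge, Prod.mk.injEq]
  omega

lemma isPaired_vertexList_iff (l : ℕ) (w : ℕ → ℕ) :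
    IsPaired (vertexList l w) ↔ ∀ k ∈ Finset.range (2 * l),
      ((Finset.range (2 * l)).filter fun t => wedge w t = wedge w k).card = 2 := by
  have key : ∀ k, ((Finset.range (2 * l)).filter fun t => wedge w t = wedge w k).card =
      (edges (vertexList l w)).count s(w k, w (k + 1)) := by
    intro k
    rw [vertexList, edges_map_range, Multiset.count_map]
    simp only [wedge_eq_iff]
    rfl
  simp only [key]
  simp only [IsPaired, vertexList, edges_map_range, Multiset.mem_map, Multiset.mem_range,
    Finset.mem_range]
  constructor
  · exact fun h k hk => h _ ⟨k, hk, rfl⟩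
  · rintro h _ ⟨k, hk, rfl⟩
    exact h k hk

/-- The entries `w 0, …, w n` are labelled in order of first appearance. -/
def IsOrderedUpTo (n : ℕ) (w : ℕ → ℕ) : Prop :=
  w 0 = 0 ∧ ∀ j, 1 ≤ j → j ≤ n → w j ≤ (Finset.range j).sup w + 1

lemma isCanonicalPairWalk_iff (l : ℕ) (w : ℕ → ℕ) :
    IsCanonicalPairWalk l w ↔ IsOrderedUpTo (2 * l) w ∧ (∀ j, 2 * l < j → w j = 0) ∧
      IsPairedLoop 0 (vertexList l w) := by
  have hh : (vertexList l w).head? = some (w 0) := by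
    simp [vertexList, List.range_succ_eq_map]
  have hl : (vertexList l w).getLast? = some (w (2 * l)) := by
    simp [vertexList, List.range_succ]
  constructor
  · rintro ⟨h0, h1, h2, h3, h4⟩
    exact ⟨⟨h0, h2⟩, h3, by rw [hh, h0], by rw [hl, h1, h0], (isPaired_vertexList_iff l w).2 h4⟩
  · rintro ⟨⟨h0, h1⟩, h2, h3⟩
    refine ⟨h0, ?_, h1, h2, (isPaired_vertexList_iff l w).1 h3.paired⟩
    rw [h0]
    exact Option.some.inj (hl.symm.trans h3.last)

lemma IsOrderedUpTo.exists_eq {n : ℕ} {w : ℕ → ℕ} (h : IsOrderedUpTo n w) (j : ℕ) (hj : j ≤ n)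
    (a : ℕ) (ha : a ≤ (Finset.range (j + 1)).sup w) : ∃ i ≤ j, w i = a := by
  induction j with
  | zero =>
    refine ⟨0, le_rfl, ?_⟩
    simp at ha
    have := h.1
    omega
  | succ j ih =>
    by_cases h1 : a ≤ (Finset.range (j + 1)).sup w
    · obtain ⟨i, hi, rfl⟩ := ih (by omega) h1
      exact ⟨i, by omega, rfl⟩
    · have h2 := h.2 (j + 1) (by omega) hj
      rw [Finset.range_add_one, Finset.sup_insert] at ha
      have h3 := le_sup_iff.1 ha
      exact ⟨j + 1, le_rfl, by omega⟩

lemma IsOrderedUpTo.eq_of_kernel_eq {n : ℕ} {w w' : ℕ → ℕ} (h : IsOrderedUpTo n w)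
    (h' : IsOrderedUpTo n w')
    (hk : ∀ i ≤ n, ∀ j ≤ n, (w i = w j ↔ w' i = w' j)) : ∀ j ≤ n, w j = w' j := by
  have fresh : ∀ {u : ℕ → ℕ}, IsOrderedUpTo n u → ∀ j, j + 1 ≤ n →
      (∀ i ≤ j, u i ≠ u (j + 1)) → u (j + 1) = (Finset.range (j + 1)).sup u + 1 := by
    intro u hu j hj hf
    refine le_antisymm (hu.2 _ (by omega) hj) ?_
    by_contra hlt
    obtain ⟨i, hi, he⟩ := hu.exists_eq j (by omega) (u (j + 1)) (by omega)
    exact hf i hi he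
  intro j
  induction j using Nat.strong_induction_on with
  | _ j ih =>
    intro hj
    cases j with
    | zero => rw [h.1, h'.1]
    | succ j =>
      by_cases hex : ∃ i ≤ j, w i = w (j + 1)
      · obtain ⟨i, hi, he⟩ := hex
        rw [← he, ih i (by omega) (by omega)]
        exact (hk i (by omega) _ hj).1 he
      · push Not at hex
        rw [fresh h j hj hex, fresh h' j hj
          (fun i hi he => hex i hi ((hk i (by omega) _ hj).2 he))]
        congr 1
        refine Finset.sup_congr rfl fun i hi => ?_
        have := Finset.mem_range.1 hi
        exact ih i this (by omega)

lemma exists_relabelling (u : ℕ → ℕ) (n : ℕ) :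
    ∃ φ : ℕ → ℕ, Set.InjOn φ (u '' Set.Iic n) ∧ IsOrderedUpTo n (φ ∘ u) := by
  induction n with
  | zero =>
    refine ⟨fun _ => 0, ?_, rfl, fun j h1 h2 => by omega⟩
    rintro _ ⟨i, hi, rfl⟩ _ ⟨j, hj, rfl⟩ _
    obtain rfl : i = 0 := by simpa using hi
    obtain rfl : j = 0 := by simpa using hj
    rfl
  | succ n ih =>
    obtain ⟨φ, hφ, hφ0, hφo⟩ := ih
    have hIic : u '' Set.Iic (n + 1) = insert (u (n + 1)) (u '' Set.Iic n) := by
      rw [← Set.image_insert_eq]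
      congr 1
      ext i
      simp
      omega
    rw [hIic]
    by_cases hu : u (n + 1) ∈ u '' Set.Iic n
    · rw [Set.insert_eq_of_mem hu]
      refine ⟨φ, hφ, hφ0, fun j hj1 hj => ?_⟩
      rcases Nat.lt_or_ge n j with hjn | hjn
      · obtain rfl : j = n + 1 := by omega
        obtain ⟨i, hi, he⟩ := hu
        have := Finset.le_sup (f := φ ∘ u) (Finset.mem_range.2 (Nat.lt_succ_of_le hi))
        simp only [Function.comp_apply, he] at this ⊢
        exact this.trans (Nat.le_succ _)
      · exact hφo j hj1 hjn
    · set m := (Finset.range (n + 1)).sup (φ ∘ u) + 1 with hm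
      have hne : ∀ i ≤ n, u i ≠ u (n + 1) := fun i hi he => hu ⟨i, hi, he⟩
      have hold : ∀ i ≤ n, Function.update φ (u (n + 1)) m (u i) = φ (u i) :=
        fun i hi => Function.update_of_ne (hne i hi) _ _
      have hsup : ∀ j ≤ n + 1, (Finset.range j).sup (Function.update φ (u (n + 1)) m ∘ u) =
          (Finset.range j).sup (φ ∘ u) := fun j hj =>
        Finset.sup_congr rfl fun i hi => hold i (by have := Finset.mem_range.1 hi; omega)
      refine ⟨Function.update φ (u (n + 1)) m, ?_, ?_, fun j hj1 hj => ?_⟩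
      · rw [Set.injOn_insert hu]
        constructor
        · rintro _ ⟨i, hi, rfl⟩ _ ⟨j, hj, rfl⟩ he
          rw [hold i hi, hold j hj] at he
          exact hφ ⟨i, hi, rfl⟩ ⟨j, hj, rfl⟩ he
        · rintro ⟨_, ⟨i, hi, rfl⟩, he⟩
          rw [hold i hi, Function.update_self] at he
          have := Finset.le_sup (f := φ ∘ u) (Finset.mem_range.2 (Nat.lt_succ_of_le hi))
          simp only [Function.comp_apply] at this
          rw [he, hm, Nat.succ_eq_add_one] at this
          omega
      · exact (hold 0 (by omega)).trans hφ0
      · rw [hsup j hj]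
        rcases Nat.lt_or_ge n j with hjn | hjn
        · obtain rfl : j = n + 1 := by omega
          simp [hm]
        · exact (hold j hjn).le.trans (hφo j hj1 hjn)

lemma IsPaired.map {u : List ℕ} {φ : ℕ → ℕ} (hφ : Set.InjOn φ {x | x ∈ u}) (h : IsPaired u) :
    IsPaired (u.map φ) := by
  have hE : ∀ L : List ℕ, edges (L.map φ) = (edges L).map (Sym2.map φ) := by
    intro L
    induction L with
    | nil => rfl
    | cons a L ih =>
      cases L with
      | nil => rfl
      | cons b L => simpa using ih
  rw [IsPaired, hE]
  intro e he
  obtain ⟨f, hf, rfl⟩ := Multiset.mem_map.1 he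
  rw [Multiset.count_map_eq_count _ _ ?_ _ hf]
  · exact h f hf
  · intro x hx y hy hxy
    induction x using Sym2.ind with
    | _ a b =>
    induction y using Sym2.ind with
    | _ c d =>
    have h1 := mem_of_mem_edges hx
    have h2 := mem_of_mem_edges hy
    simp only [Sym2.map_mk, Sym2.eq_iff] at hxy ⊢
    rcases hxy with ⟨h3, h4⟩ | ⟨h3, h4⟩
    · exact Or.inl ⟨hφ h1.1 h2.1 h3, hφ h1.2 h2.2 h4⟩
    · exact Or.inr ⟨hφ h1.1 h2.2 h3, hφ h1.2 h2.1 h4⟩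

lemma IsPairedLoop.exists_canonical {l v : ℕ} {u : List ℕ} (h : IsPairedLoop v u)
    (hlen : u.length = 2 * l + 1) :
    ∃ φ w, Set.InjOn φ {x | x ∈ u} ∧ IsCanonicalPairWalk l w ∧ vertexList l w = u.map φ ∧
      multIn l w (w 0) = u.count v := by
  obtain ⟨φ, hφ, hφo⟩ := exists_relabelling (fun j => u.getD j 0) (2 * l)
  have hmem : ((fun j => u.getD j 0) '' Set.Iic (2 * l)) = {x | x ∈ u} := by
    ext x
    simp only [Set.mem_image, Set.mem_Iic, Set.mem_ofPred_eq, List.mem_iff_getElem]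
    constructor
    · rintro ⟨j, hj, rfl⟩
      exact ⟨j, by omega, by rw [List.getD_eq_getElem]⟩
    · rintro ⟨j, hj, rfl⟩
      exact ⟨j, by omega, by rw [List.getD_eq_getElem]⟩
  rw [hmem] at hφ
  set w : ℕ → ℕ := fun j => if j ≤ 2 * l then φ (u.getD j 0) else 0 with hw
  have hwj : ∀ j ≤ 2 * l, w j = φ (u.getD j 0) := fun j hj => if_pos hj
  have hlist : vertexList l w = u.map φ := by
    apply List.ext_getElem
    · simp [vertexList, hlen]
    · intro j h1 h2
      simp only [length_vertexList] at h1
      simp only [vertexList, List.getElem_map, List.getElem_range]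
      rw [hwj j (by omega), List.getD_eq_getElem]
  have hv : v ∈ u := List.mem_of_mem_head? h.head
  have hw0 : w 0 = φ v := by
    obtain ⟨T, rfl⟩ := List.head?_eq_some_iff.1 h.head
    simp [hw]
  have hord : IsOrderedUpTo (2 * l) w := by
    refine ⟨(hwj 0 (by omega)).trans hφo.1, fun j hj1 hj => ?_⟩
    rw [hwj j hj]
    refine (hφo.2 j hj1 hj).trans_eq ?_
    congr 1
    refine Finset.sup_congr rfl fun i hi => (hwj i ?_).symm
    have := Finset.mem_range.1 hi
    omega
  have hφv : φ v = 0 := by rw [← hw0, hord.1]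
  refine ⟨φ, w, hφ, (isCanonicalPairWalk_iff l w).2 ⟨hord, fun j hj => if_neg (by omega), ?_⟩,
    hlist, ?_⟩
  · rw [hlist]
    exact ⟨by simp [h.head, hφv], by simp [h.last, hφv], h.paired.map hφ⟩
  · rw [multIn_eq_count, hlist, hw0, List.count, List.countP_map, List.count]
    refine List.countP_congr fun x hx => ?_
    simp only [Function.comp_apply, beq_iff_eq]
    exact ⟨fun he => hφ hx hv he, fun he => by rw [he]⟩

lemma IsCanonicalPairWalk.eq_of_kernel_eq {l : ℕ} {w w' : ℕ → ℕ} (h : IsCanonicalPairWalk l w)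
    (h' : IsCanonicalPairWalk l w')
    (hk : ∀ i ≤ 2 * l, ∀ j ≤ 2 * l, (w i = w j ↔ w' i = w' j)) : w = w' := by
  rw [isCanonicalPairWalk_iff] at h h'
  funext j
  rcases Nat.lt_or_ge (2 * l) j with hj | hj
  · rw [h.2.1 j hj, h'.2.1 j hj]
  · exact h.1.eq_of_kernel_eq h'.1 hk j hj

lemma IsCanonicalPairWalk.eq_of_map_eq {l : ℕ} {w w' φ φ' : ℕ → ℕ} (h : IsCanonicalPairWalk l w)
    (h' : IsCanonicalPairWalk l w')
    (hφ : Set.InjOn φ {x | x ∈ vertexList l w}) (hφ' : Set.InjOn φ' {x | x ∈ vertexList l w'})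
    (he : (vertexList l w).map φ = (vertexList l w').map φ') : w = w' := by
  have hj : ∀ j ≤ 2 * l, φ (w j) = φ' (w' j) := by
    simp only [vertexList, List.map_map] at he
    intro j hj
    exact List.map_inj_left.1 he j (List.mem_range.2 (by omega))
  have hmem : ∀ u j, j ≤ 2 * l → u j ∈ vertexList l u := fun u j hj =>
    List.mem_map.2 ⟨j, List.mem_range.2 (by omega), rfl⟩
  refine h.eq_of_kernel_eq h' fun i hi k hk => ?_
  rw [← hφ.eq_iff (hmem w i hi) (hmem w k hk), ← hφ'.eq_iff (hmem w' i hi) (hmem w' k hk),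
    hj i hi, hj k hk]

instance finite_canonicalPairWalk (l : ℕ) : Finite {w : ℕ → ℕ // IsCanonicalPairWalk l w} := by
  refine Finite.of_injective
    (fun w (i j : Fin (2 * l + 1)) => w.1 i = w.1 j) fun w w' h => Subtype.ext ?_
  refine w.2.eq_of_kernel_eq w'.2 fun i hi j hj => ?_
  exact iff_of_eq (congrFun (congrFun h ⟨i, by omega⟩) ⟨j, by omega⟩)

lemma finite_canonicalPairWalk_and (l : ℕ) (p : (ℕ → ℕ) → Prop) :
    Finite {w : ℕ → ℕ // IsCanonicalPairWalk l w ∧ p w} :=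
  Finite.of_injective (fun w => (⟨w.1, w.2.1⟩ : {w : ℕ → ℕ // IsCanonicalPairWalk l w}))
    fun _ _ h => Subtype.ext (congrArg (fun x => x.1) h)

lemma card_le_mul_fCount {ι : Type} [Finite ι] {l t : ℕ} {p : (ℕ → ℕ) → Prop}
    (dec : ι → List ℕ → List ℕ)
    (hmap : ∀ i φ u, dec i (u.map φ) = (dec i u).map φ)
    (hmem : ∀ i u x, x ∈ dec i u → x ∈ u)
    (h : ∀ w, IsCanonicalPairWalk l w → p w → ∃ i v u, IsPairedLoop v u ∧
      u.length = 2 * l + 1 ∧ u.count v = t ∧ dec i u = vertexList l w) :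
    Nat.card {w : ℕ → ℕ // IsCanonicalPairWalk l w ∧ p w} ≤ Nat.card ι * fCount l t := by
  have key : ∀ w : {w : ℕ → ℕ // IsCanonicalPairWalk l w ∧ p w},
      ∃ x : ι × {w : ℕ → ℕ // IsCanonicalPairWalk l w ∧ multIn l w (w 0) = t},
      ∃ φ, Set.InjOn φ {x | x ∈ vertexList l w.1} ∧
        (vertexList l w.1).map φ = dec x.1 (vertexList l x.2.1) := by
    rintro ⟨w, hw, hp⟩
    obtain ⟨i, v, u, hu, hlen, hc, hdec⟩ := h w hw hp
    obtain ⟨φ, w', hφ, hw', hlist, hm⟩ := hu.exists_canonical hlen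
    refine ⟨(i, ⟨w', hw', hm.trans hc⟩), φ, hφ.mono fun x hx => ?_, ?_⟩
    · exact hmem i u x (hdec ▸ hx)
    · simp only [hlist, hmap, hdec]
  choose f φ hφ hf using key
  have := finite_canonicalPairWalk_and l fun w => multIn l w (w 0) = t
  rw [fCount, ← Nat.card_prod]
  refine Nat.card_le_card_of_injective f fun w w' he => Subtype.ext ?_
  exact w.2.1.eq_of_map_eq w'.2.1 (hφ w) (hφ w') (by rw [hf, hf, he])

lemma card_multIn_apply_le (l t p : ℕ) (ht : 2 ≤ t) (hp : p ≤ 2 * l) :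
    Nat.card {w : ℕ → ℕ // IsCanonicalPairWalk l w ∧ multIn l w (w p) = t} ≤
      (1 + 4 * (2 * l + 2) ^ 3) * fCount l t := by
  have hcard : Nat.card (Option (Fin 4 × Fin (2 * l + 2) × Fin (2 * l + 2) × Fin (2 * l + 2))) =
      1 + 4 * (2 * l + 2) ^ 3 := by
    rw [Finite.card_option]
    simp
    ring
  rw [← hcard]
  refine card_le_mul_fCount (fun i u => i.elim u fun ⟨k, a, b, d⟩ =>
    undoRotation (2 * l - p) (undoSurgery k a b d u)) ?_ ?_ ?_
  · rintro (_ | ⟨k, a, b, d⟩) φ u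
    · rfl
    · simp only [Option.elim_some, undoSurgery_map, undoRotation_map]
  · rintro (_ | ⟨k, a, b, d⟩) u x hx
    · exact hx
    · exact mem_of_mem_undoSurgery (mem_of_mem_undoRotation hx)
  · intro w hw hm
    have hL := ((isCanonicalPairWalk_iff l w).1 hw).2.2
    rw [multIn_eq_count] at hm
    by_cases hwp : w p = 0
    · exact ⟨none, 0, vertexList l w, hL, length_vertexList l w, hwp ▸ hm, rfl⟩
    · obtain ⟨P, Q, hPQ, hQ⟩ : ∃ P Q, vertexList l w = P ++ w p :: Q ∧ Q.length = 2 * l - p := by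
        have hlt : p < (vertexList l w).length := by rw [length_vertexList]; omega
        refine ⟨(vertexList l w).take p, (vertexList l w).drop (p + 1), ?_, ?_⟩
        · have hg : w p = (vertexList l w)[p] := by simp [vertexList]
          rw [hg, ← List.drop_eq_getElem_cons, List.take_append_drop]
        · rw [List.length_drop, length_vertexList]; omega
      have hlen := length_vertexList l w
      rw [hPQ] at hL hm hlen
      obtain ⟨r, hr, hrlen, hrc, hrot⟩ := hL.exists_rotation hwp
      obtain ⟨u, k, a, b, d, hu, hulen, huc, hsur, hk, ha, hb, hd⟩ :=
        hr.isReducible ht (hrc.trans (by rw [hm]))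
      refine ⟨some (⟨k, hk⟩, ⟨a, by omega⟩, ⟨b, by omega⟩, ⟨d, by omega⟩), w p, u, hu,
        by omega, huc, ?_⟩
      simp only [Option.elim_some, hsur]
      rw [← hQ, hrot, hPQ]

lemma exists_apply_eq_of_multIn_pos {l v : ℕ} {w : ℕ → ℕ} (h : 0 < multIn l w v) :
    ∃ p < 2 * l + 1, w p = v := by
  obtain ⟨p, hp⟩ := Finset.card_pos.1 h
  exact ⟨p, by simpa using hp⟩

lemma exists_embedding_sigma (l t : ℕ) (ht : 1 ≤ t) :
    ∃ f : {q : (ℕ → ℕ) × ℕ // IsCanonicalPairWalk l q.1 ∧ multIn l q.1 q.2 = t} →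
      Σ p : Fin (2 * l + 1), {w : ℕ → ℕ // IsCanonicalPairWalk l w ∧ multIn l w (w p) = t},
      Function.Injective f := by
  have key : ∀ q : {q : (ℕ → ℕ) × ℕ // IsCanonicalPairWalk l q.1 ∧ multIn l q.1 q.2 = t},
      ∃ x : Σ p : Fin (2 * l + 1), {w : ℕ → ℕ // IsCanonicalPairWalk l w ∧ multIn l w (w p) = t},
        q.1 = (x.2.1, x.2.1 x.1) := by
    rintro ⟨⟨w, v⟩, hw, hm⟩
    obtain ⟨p, hp, rfl⟩ : ∃ p < 2 * l + 1, w p = v :=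
      exists_apply_eq_of_multIn_pos (hm.symm ▸ ht)
    exact ⟨⟨⟨p, hp⟩, w, hw, hm⟩, rfl⟩
  choose f hf using key
  exact ⟨f, fun q q' he => Subtype.ext (by rw [hf, hf, he])⟩

/-- for `l ≥ 1` and `2 ≤ t ≤ l+1`,
`f_{l,t} ≤ b_{l,t} ≤ (l+1)^{120}·f_{l,t}`. -/
theorem bCount_between_fCount_multiples (l t : ℕ) (hl : 1 ≤ l) (ht1 : 2 ≤ t)
    (ht2 : t ≤ l + 1) :
    fCount l t ≤ bCount l t ∧ bCount l t ≤ (l + 1) ^ 120 * fCount l t := by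
  obtain ⟨f, hf⟩ := exists_embedding_sigma l t (by omega)
  have hfin : ∀ p : Fin (2 * l + 1),
      Finite {w : ℕ → ℕ // IsCanonicalPairWalk l w ∧ multIn l w (w p) = t} := fun p =>
    finite_canonicalPairWalk_and l _
  constructor
  · have := Finite.of_injective f hf
    refine Nat.card_le_card_of_injective (fun w => ⟨(w.1, w.1 0), w.2⟩) fun w w' h => ?_
    exact Subtype.ext (congrArg (fun x => x.1.1) h)
  · have hpow : (2 * l + 1) * (1 + 4 * (2 * l + 2) ^ 3) ≤ (l + 1) ^ 120 := by
      have h2 : 2 * l + 2 ≤ (l + 1) ^ 2 := by nlinarith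
      calc (2 * l + 1) * (1 + 4 * (2 * l + 2) ^ 3)
          ≤ (2 * l + 2) * ((2 * l + 2) ^ 3 * (2 * l + 2) ^ 3) := by
            have h3 : 4 ^ 3 ≤ (2 * l + 2) ^ 3 := Nat.pow_le_pow_left (by omega) 3
            gcongr
            · omega
            · nlinarith
        _ = (2 * l + 2) ^ 7 := by ring
        _ ≤ ((l + 1) ^ 2) ^ 7 := Nat.pow_le_pow_left h2 7
        _ = (l + 1) ^ 14 := by ring
        _ ≤ (l + 1) ^ 120 := Nat.pow_le_pow_right (by omega) (by omega)
    calc bCount l t ≤ Nat.card (Σ p : Fin (2 * l + 1),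
          {w : ℕ → ℕ // IsCanonicalPairWalk l w ∧ multIn l w (w p) = t}) :=
          Nat.card_le_card_of_injective f hf
      _ = ∑ p : Fin (2 * l + 1),
          Nat.card {w : ℕ → ℕ // IsCanonicalPairWalk l w ∧ multIn l w (w p) = t} :=
          Nat.card_sigma
      _ ≤ ∑ _p : Fin (2 * l + 1), (1 + 4 * (2 * l + 2) ^ 3) * fCount l t :=
          Finset.sum_le_sum fun p _ => card_multIn_apply_le l t p ht1 (by omega)
      _ = (2 * l + 1) * (1 + 4 * (2 * l + 2) ^ 3) * fCount l t := by
          simp [mul_assoc]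
      _ ≤ (l + 1) ^ 120 * fCount l t := Nat.mul_le_mul_right _ hpow
end

section
/- Fix M > 0 and let h : D → (0,∞) be defined by h(x,y,z) = M^{2x} · (x−y+z)^{x−y+z} / ( (x−y)^{x−y} · (2y)^{2y} · (z−2y)^{z−2y} ) · (2−2x−z)^{2−2x−z} / ( (1−x)^{1−x} · (1−x−z)^{1−x−z} ), where D = {(x,y,z) ∈ ℝ³ : 0 ≤ x ≤ 1, 0 ≤ z ≤ 1−x, 0 ≤ y ≤ min(z/2, x)} and 0⁰ := 1. Then sup_{(x,y,z) ∈ D} h(x,y,z) = 4 if M ≤ 1, and sup_{(x,y,z) ∈ D} h(x,y,z) = (M²+1)²/M² if M ≥ 1. -/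
/-- The function `h(x,y,z)` (all powers are real powers, with `0^0 = 1`). -/
noncomputable def hfun (M x y z : ℝ) : ℝ :=
  M ^ (2 * x) *
    ((x - y + z) ^ (x - y + z) /
      ((x - y) ^ (x - y) * (2 * y) ^ (2 * y) * (z - 2 * y) ^ (z - 2 * y))) *
    ((2 - 2 * x - z) ^ (2 - 2 * x - z) /
      ((1 - x) ^ (1 - x) * (1 - x - z) ^ (1 - x - z)))

/-- The domain `D = {(x,y,z) : 0 ≤ x ≤ 1, 0 ≤ z ≤ 1−x, 0 ≤ y ≤ min(z/2, x)}`. -/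
def Dset : Set (ℝ × ℝ × ℝ) :=
  {p | 0 ≤ p.1 ∧ p.1 ≤ 1 ∧ 0 ≤ p.2.2 ∧ p.2.2 ≤ 1 - p.1 ∧
    0 ≤ p.2.1 ∧ p.2.1 ≤ min (p.2.2 / 2) p.1}

open Real in
lemma rpow_self_eq_exp {t : ℝ} (ht : 0 ≤ t) : t ^ t = exp (t * log t) := by
  rcases ht.eq_or_lt with rfl | h
  · simp
  · rw [rpow_def_of_pos h, mul_comm]

open Real in
lemma mul_log_add_sub_le {a r : ℝ} (ha : 0 ≤ a) (hr : 0 < r) :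
    a * log r + a - r ≤ a * log a := by
  rcases ha.eq_or_lt with rfl | h
  · simpa using hr.le
  · have h1 := log_le_sub_one_of_pos (div_pos hr h)
    rw [log_div hr.ne' h.ne'] at h1
    have h2 := mul_le_mul_of_nonneg_left h1 ha
    have h3 : a * (r / a - 1) = r - a := by field_simp
    linarith

open Real in
/-- Gibbs' inequality, for an unnormalised family `a` and a probability vector `p`. -/
lemma sum_mul_log_sub_le {ι : Type*} (s : Finset ι) (a p : ι → ℝ) (ha : ∀ i ∈ s, 0 ≤ a i)
    (hp : ∀ i ∈ s, 0 < p i) (hsum : ∑ i ∈ s, p i = 1) :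
    (∑ i ∈ s, a i) * log (∑ i ∈ s, a i) - ∑ i ∈ s, a i * log (a i)
      ≤ -∑ i ∈ s, a i * log (p i) := by
  set S := ∑ i ∈ s, a i with hS
  rcases (Finset.sum_nonneg ha).eq_or_lt with h | h
  · have h0 : ∀ i ∈ s, a i = 0 := (Finset.sum_eq_zero_iff_of_nonneg ha).1 h.symm
    rw [Finset.sum_eq_zero (fun i hi => by rw [h0 i hi, zero_mul] : ∀ i ∈ s, a i * log (a i) = 0),
      Finset.sum_eq_zero (fun i hi => by rw [h0 i hi, zero_mul] : ∀ i ∈ s, a i * log (p i) = 0),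
      hS, ← h]
    simp
  · have hle : ∑ i ∈ s, (a i * log S + a i * log (p i) + a i - S * p i)
        ≤ ∑ i ∈ s, a i * log (a i) := by
      refine Finset.sum_le_sum fun i hi => ?_
      have := mul_log_add_sub_le (ha i hi) (mul_pos h (hp i hi))
      rw [log_mul h.ne' (hp i hi).ne'] at this
      linarith
    simp only [Finset.sum_sub_distrib, Finset.sum_add_distrib, ← Finset.sum_mul,
      ← Finset.mul_sum, hsum, ← hS] at hle
    linarith

open Real in
lemma mul_mul_log_mul {S p : ℝ} (hp : 0 < p) :
    S * p * log (S * p) = S * p * log S + S * p * log p := by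
  rcases eq_or_ne S 0 with rfl | h
  · simp
  · rw [log_mul h hp.ne', mul_add]

open Real in
lemma hfun_eq_exp {M x y z : ℝ} (hM : 0 < M) (h : (x, y, z) ∈ Dset) :
    hfun M x y z = exp (x * log (M ^ 2)
      + ((x - y + z) * log (x - y + z) - ((x - y) * log (x - y) + (2 * y) * log (2 * y)
        + (z - 2 * y) * log (z - 2 * y)))
      + ((2 - 2 * x - z) * log (2 - 2 * x - z) - ((1 - x) * log (1 - x)
        + (1 - x - z) * log (1 - x - z)))) := by
  obtain ⟨h1, h2, h3, h4, h5, h6⟩ := h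
  obtain ⟨h7, h8⟩ := le_min_iff.1 h6
  simp only at h1 h2 h3 h4 h5 h7 h8
  rw [hfun, rpow_def_of_pos hM, rpow_self_eq_exp (t := x - y + z) (by linarith),
    rpow_self_eq_exp (t := x - y) (by linarith), rpow_self_eq_exp (t := 2 * y) (by linarith),
    rpow_self_eq_exp (t := z - 2 * y) (by linarith),
    rpow_self_eq_exp (t := 2 - 2 * x - z) (by linarith),
    rpow_self_eq_exp (t := 1 - x) (by linarith),
    rpow_self_eq_exp (t := 1 - x - z) (by linarith)]
  simp only [← exp_add, ← exp_sub]
  rw [log_pow]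
  congr 1
  push_cast
  ring

open Real in
lemma exp_two_mul_log_sub {m : ℝ} (hm : 0 < m) :
    exp (2 * log (m + 1) - log m) = (m + 1) ^ 2 / m := by
  rw [exp_sub, exp_log hm, mul_comm, exp_mul, exp_log (by linarith)]
  norm_cast

open Real in
lemma log_div_add_one {m : ℝ} (hm : 0 < m) :
    log (m ^ 2 / (m + 1) ^ 2) = 2 * (log m - log (m + 1)) ∧
    log (m / (m + 1) ^ 2) = log m - 2 * log (m + 1) ∧
    log (1 / (m + 1)) = -log (m + 1) ∧
    log (m / (m + 1)) = log m - log (m + 1) := by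
  have h : m + 1 ≠ 0 := by positivity
  refine ⟨?_, ?_, ?_, ?_⟩
  · rw [log_div (by positivity) (by positivity), log_pow, log_pow]; push_cast; ring
  · rw [log_div (by positivity) (by positivity), log_pow]; push_cast; ring
  · rw [log_div one_ne_zero h, log_one, zero_sub]
  · rw [log_div hm.ne' h]

open Real in
lemma hfun_le {M x y z : ℝ} (hM : 0 < M) (h : (x, y, z) ∈ Dset) :
    hfun M x y z ≤ (M ^ 2 + 1) ^ 2 / M ^ 2 := by
  rw [hfun_eq_exp hM h]
  obtain ⟨h1, h2, h3, h4, h5, h6⟩ := h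
  obtain ⟨h7, h8⟩ := le_min_iff.1 h6
  simp only at h1 h2 h3 h4 h5 h7 h8
  have hm : 0 < M ^ 2 := by positivity
  generalize M ^ 2 = m at hm ⊢
  rw [← exp_two_mul_log_sub hm, exp_le_exp]
  obtain ⟨hu, hv, hw, ha⟩ := log_div_add_one hm
  have g1 := sum_mul_log_sub_le Finset.univ ![x - y, 2 * y, z - 2 * y]
    ![m ^ 2 / (m + 1) ^ 2, m / (m + 1) ^ 2, 1 / (m + 1)]
    (by simp only [Finset.mem_univ, forall_const, Fin.forall_fin_succ]; simp; grind)
    (by simp only [Finset.mem_univ, forall_const, Fin.forall_fin_succ]; simp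
        exact ⟨by positivity, by positivity, by positivity⟩)
    (by simp [Fin.sum_univ_three]; field_simp)
  have g2 := sum_mul_log_sub_le Finset.univ ![1 - x, 1 - x - z] ![m / (m + 1), 1 / (m + 1)]
    (by simp only [Finset.mem_univ, forall_const, Fin.forall_fin_succ]; simp; grind)
    (by simp only [Finset.mem_univ, forall_const, Fin.forall_fin_succ]; simp
        exact ⟨by positivity, by positivity⟩)
    (by simp [Fin.sum_univ_two]; field_simp)
  simp only [Fin.sum_univ_three, Fin.sum_univ_two, Matrix.cons_val, hu, hv, hw, ha] at g1 g2
  rw [show x - y + 2 * y + (z - 2 * y) = x - y + z by ring] at g1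
  rw [show 1 - x + (1 - x - z) = 2 - 2 * x - z by ring] at g2
  linarith

open Real in
lemma exists_hfun_eq {M : ℝ} (hM : 1 ≤ M) :
    ∃ x y z : ℝ, (x, y, z) ∈ Dset ∧ hfun M x y z = (M ^ 2 + 1) ^ 2 / M ^ 2 := by
  have hm1 : 1 ≤ M ^ 2 := one_le_pow₀ hM
  obtain ⟨m, hmM⟩ : ∃ m, m = M ^ 2 := ⟨_, rfl⟩
  rw [← hmM] at hm1
  have hm : 0 < m := by linarith
  have hm0 : 0 ≤ m - 1 := by linarith
  obtain ⟨x, hx⟩ : ∃ x, x = (m - 1) / (m + 1) := ⟨_, rfl⟩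
  obtain ⟨y, hy⟩ : ∃ y, y = (m - 1) / ((2 * m + 1) * (m + 1)) := ⟨_, rfl⟩
  obtain ⟨z, hz⟩ : ∃ z, z = 2 * (m - 1) / (m * (m + 1)) := ⟨_, rfl⟩
  have e1 : x - y = (x - y + z) * (m ^ 2 / (m + 1) ^ 2) := by
    subst hx hy hz; field_simp; ring
  have e2 : 2 * y = (x - y + z) * (m / (m + 1) ^ 2) := by
    subst hx hy hz; field_simp; ring
  have e3 : z - 2 * y = (x - y + z) * (1 / (m + 1)) := by
    subst hx hy hz; field_simp; ring
  have e4 : 1 - x = (2 - 2 * x - z) * (m / (m + 1)) := by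
    subst hx hz; field_simp; ring
  have e5 : 1 - x - z = (2 - 2 * x - z) * (1 / (m + 1)) := by
    subst hx hz; field_simp; ring
  have hS : x - y + z = 2 * (m - 1) * (m + 1) / (m * (2 * m + 1)) := by
    subst hx hy hz; field_simp; ring
  have hT : 2 - 2 * x - z = 2 / m := by
    subst hx hz; field_simp; ring
  have hS0 : 0 ≤ x - y + z := by rw [hS]; positivity
  have hT0 : 0 ≤ 2 - 2 * x - z := by rw [hT]; positivity
  have p0 : 0 ≤ x := by rw [hx]; positivity
  have p1 : 0 ≤ x - y := by rw [e1]; positivity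
  have p2 : 0 ≤ 2 * y := by rw [e2]; positivity
  have p3 : 0 ≤ z - 2 * y := by rw [e3]; positivity
  have p4 : 0 ≤ 1 - x := by rw [e4]; positivity
  have p5 : 0 ≤ 1 - x - z := by rw [e5]; positivity
  have hD : (x, y, z) ∈ Dset := by
    refine ⟨p0, ?_, ?_, ?_, ?_, le_min ?_ ?_⟩ <;> simp only <;> linarith
  refine ⟨x, y, z, hD, ?_⟩
  rw [hfun_eq_exp (by linarith) hD, ← hmM, ← exp_two_mul_log_sub hm]
  congr 1
  obtain ⟨hu, hv, hw, ha⟩ := log_div_add_one hm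
  have f1 := mul_mul_log_mul (S := x - y + z) (p := m ^ 2 / (m + 1) ^ 2) (by positivity)
  have f2 := mul_mul_log_mul (S := x - y + z) (p := m / (m + 1) ^ 2) (by positivity)
  have f3 := mul_mul_log_mul (S := x - y + z) (p := 1 / (m + 1)) (by positivity)
  have f4 := mul_mul_log_mul (S := 2 - 2 * x - z) (p := m / (m + 1)) (by positivity)
  have f5 := mul_mul_log_mul (S := 2 - 2 * x - z) (p := 1 / (m + 1)) (by positivity)
  rw [← e1, hu] at f1
  rw [← e2, hv] at f2
  rw [← e3, hw] at f3
  rw [← e4, ha] at f4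
  rw [← e5, hw] at f5
  rw [f1, f2, f3, f4, f5]
  ring

/-- `sup_D h = 4` if `M ≤ 1` and `sup_D h = (M²+1)²/M²` if `M ≥ 1`. -/
theorem sup_hfun_on_D (M : ℝ) (hM : 0 < M) :
    (M ≤ 1 → sSup ((fun p : ℝ × ℝ × ℝ => hfun M p.1 p.2.1 p.2.2) '' Dset) = 4) ∧
      (1 ≤ M → sSup ((fun p : ℝ × ℝ × ℝ => hfun M p.1 p.2.1 p.2.2) '' Dset)
        = (M ^ 2 + 1) ^ 2 / M ^ 2) := by
  refine ⟨fun h => IsGreatest.csSup_eq ⟨⟨(0, 0, 0), ?_, ?_⟩, ?_⟩,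
    fun h => IsGreatest.csSup_eq ⟨?_, ?_⟩⟩
  · simp [Dset]
  · norm_num [hfun]
  · rintro _ ⟨⟨x, y, z⟩, hp, rfl⟩
    have h4 := hfun_le one_pos hp
    norm_num at h4
    refine le_trans ?_ h4
    change hfun M x y z ≤ hfun 1 x y z
    rw [hfun_eq_exp hM hp, hfun_eq_exp one_pos hp, Real.exp_le_exp]
    have hlog : Real.log (M ^ 2) ≤ Real.log (1 ^ 2) :=
      Real.log_le_log (by positivity) (by gcongr)
    have := mul_le_mul_of_nonneg_left hlog hp.1
    linarith
  · obtain ⟨x, y, z, hD, he⟩ := exists_hfun_eq h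
    exact ⟨(x, y, z), hD, he⟩
  · rintro _ ⟨⟨x, y, z⟩, hp, rfl⟩
    exact hfun_le hM hp
end

section
/- For every M > 0, sup_{x ∈ [0,1]} M^{2x} / ( x^x · (1−x)^{1−x} ) = M² + 1, and the supremum is attained at x = M²/(M²+1). -/
theorem rpow_two_mul_div_rpow_self_mul_eq {M x : ℝ} (hM : 0 ≤ M) (hx : x ∈ Set.Icc (0 : ℝ) 1) :
    M ^ (2 * x) / (x ^ x * (1 - x) ^ (1 - x)) =
      (M ^ 2 / x) ^ x * (1 / (1 - x)) ^ (1 - x) := by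
  have hx1 : 0 ≤ 1 - x := sub_nonneg.2 hx.2
  rw [Real.div_rpow (sq_nonneg M) hx.1, Real.div_rpow zero_le_one hx1, Real.one_rpow,
    Real.rpow_mul hM, Real.rpow_two, div_mul_div_comm, mul_one]

theorem rpow_two_mul_div_rpow_self_mul_le {M x : ℝ} (hM : 0 ≤ M) (hx : x ∈ Set.Icc (0 : ℝ) 1) :
    M ^ (2 * x) / (x ^ x * (1 - x) ^ (1 - x)) ≤ M ^ 2 + 1 := by
  have hx1 : 0 ≤ 1 - x := sub_nonneg.2 hx.2
  have mul_div_le {a b : ℝ} (ha : 0 ≤ a) : b * (a / b) ≤ a := by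
    rcases eq_or_ne b 0 with rfl | hb
    · simpa using ha
    · rw [mul_div_cancel₀ a hb]
  rw [rpow_two_mul_div_rpow_self_mul_eq hM hx]
  calc (M ^ 2 / x) ^ x * (1 / (1 - x)) ^ (1 - x)
      ≤ x * (M ^ 2 / x) + (1 - x) * (1 / (1 - x)) :=
        Real.geom_mean_le_arith_mean2_weighted hx.1 hx1 (div_nonneg (sq_nonneg M) hx.1)
          (div_nonneg zero_le_one hx1) (by ring)
    _ ≤ M ^ 2 + 1 := add_le_add (mul_div_le (sq_nonneg M)) (mul_div_le zero_le_one)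


/-- for `M > 0`,
`sup_{x ∈ [0,1]} M^{2x} / (x^x (1−x)^{1−x}) = M² + 1`, attained at `x = M²/(M²+1)`
(real powers, with `0^0 = 1`). -/
theorem sup_entropy_like_function (M : ℝ) (hM : 0 < M) :
    sSup ((fun x : ℝ => M ^ (2 * x) / (x ^ x * (1 - x) ^ (1 - x))) '' Set.Icc 0 1)
        = M ^ 2 + 1 ∧
      (fun x : ℝ => M ^ (2 * x) / (x ^ x * (1 - x) ^ (1 - x))) (M ^ 2 / (M ^ 2 + 1))
        = M ^ 2 + 1 := by
  have hS : 0 < M ^ 2 + 1 := by positivity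
  have hmem : M ^ 2 / (M ^ 2 + 1) ∈ Set.Icc (0 : ℝ) 1 :=
    ⟨by positivity, (div_le_one hS).2 (by linarith)⟩
  have hval : (fun x : ℝ => M ^ (2 * x) / (x ^ x * (1 - x) ^ (1 - x))) (M ^ 2 / (M ^ 2 + 1))
      = M ^ 2 + 1 := by
    have h₁ : M ^ 2 / (M ^ 2 / (M ^ 2 + 1)) = M ^ 2 + 1 := by field_simp
    have h₂ : 1 / (1 - M ^ 2 / (M ^ 2 + 1)) = M ^ 2 + 1 := by
      rw [one_sub_div hS.ne', add_sub_cancel_left, one_div_one_div]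
    beta_reduce
    rw [rpow_two_mul_div_rpow_self_mul_eq hM.le hmem, h₁, h₂, ← Real.rpow_add hS,
      add_sub_cancel, Real.rpow_one]
  refine ⟨IsGreatest.csSup_eq ⟨⟨_, hmem, hval⟩, ?_⟩, hval⟩
  rintro _ ⟨x, hx, rfl⟩
  exact rpow_two_mul_div_rpow_self_mul_le hM.le hx
end

section
/- For every M > 0, sup_{x ∈ [0,1]} M^{2x} · (1+x)^{1+x} / ( (2x)^{2x} · (1−x)^{1−x} ) = (M + √(M²+4))² / 4, and the supremum is attained at the point x ∈ (0,1) with x² = M²/(M²+4). -/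
open Real in
/-- On `(0, 1)` the objective is `r ^ 2` times the exponential of a relative-entropy term. -/
lemma entropyLike_eq_sq_mul_exp {M r x : ℝ} (hM : 0 < M) (hr : 0 < r) (hx : x ∈ Set.Ioo (0 : ℝ) 1) :
    M ^ (2 * x) * (1 + x) ^ (1 + x) / ((2 * x) ^ (2 * x) * (1 - x) ^ (1 - x)) =
      r ^ 2 * exp (2 * x * log (M * (1 + x) / (2 * x * r)) +
        (1 - x) * log ((1 + x) / ((1 - x) * r ^ 2))) := by
  obtain ⟨hx0, hx1⟩ := hx
  have h1 : 0 < 1 - x := by linarith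
  have h2 : 0 < 1 + x := by linarith
  have h3 : 0 < 2 * x := by linarith
  have hr2 : r ^ 2 = exp (2 * log r) := by
    rw [two_mul, exp_add, exp_log hr, sq]
  rw [rpow_def_of_pos hM, rpow_def_of_pos h2, rpow_def_of_pos h3, rpow_def_of_pos h1,
    log_div (by positivity) (by positivity), log_div (by positivity) (by positivity),
    log_mul hM.ne' h2.ne', log_mul h3.ne' hr.ne', log_mul h1.ne' (by positivity), log_pow,
    hr2, ← exp_add, ← exp_add, ← exp_add, ← exp_sub]
  congr 1
  push_cast
  ring

lemma entropyLike_le_sq {M r x : ℝ} (hM : 0 < M) (hr : 0 < r) (hMr : r ^ 2 = M * r + 1)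
    (hx : x ∈ Set.Icc (0 : ℝ) 1) :
    M ^ (2 * x) * (1 + x) ^ (1 + x) / ((2 * x) ^ (2 * x) * (1 - x) ^ (1 - x)) ≤ r ^ 2 := by
  rcases hx.1.eq_or_lt with rfl | hx0
  · have h1 : 1 ≤ r ^ 2 := by nlinarith [mul_pos hM hr]
    simpa using h1
  rcases hx.2.eq_or_lt with rfl | hx1
  · norm_num
    have hle : M ≤ r := by
      by_contra! h
      nlinarith
    exact pow_le_pow_left₀ hM.le hle 2
  rw [entropyLike_eq_sq_mul_exp hM hr ⟨hx0, hx1⟩]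
  refine mul_le_of_le_one_right (by positivity) (Real.exp_le_one_iff.mpr ?_)
  have h1 : 0 < 1 - x := by linarith
  have hu := Real.log_le_sub_one_of_pos (x := M * (1 + x) / (2 * x * r)) (by positivity)
  have hv := Real.log_le_sub_one_of_pos (x := (1 + x) / ((1 - x) * r ^ 2)) (by positivity)
  calc _ ≤ 2 * x * (M * (1 + x) / (2 * x * r) - 1) +
        (1 - x) * ((1 + x) / ((1 - x) * r ^ 2) - 1) := by gcongr
    _ = (1 + x) * ((M * r + 1) / r ^ 2 - 1) := by field_simp; ring
    _ = 0 := by rw [← hMr, div_self (by positivity)]; ring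

lemma entropyLike_eq_sq {M r x : ℝ} (hM : 0 < M) (hr : 0 < r) (hMr : r ^ 2 = M * r + 1)
    (hx : x ∈ Set.Ioo (0 : ℝ) 1) (hxr : x * (2 * r - M) = M) :
    M ^ (2 * x) * (1 + x) ^ (1 + x) / ((2 * x) ^ (2 * x) * (1 - x) ^ (1 - x)) = r ^ 2 := by
  have hx0 := hx.1
  have h1 : 0 < 1 - x := sub_pos.mpr hx.2
  have hu : M * (1 + x) / (2 * x * r) = 1 := by
    rw [div_eq_one_iff_eq (by positivity)]
    linarith
  have hv : (1 + x) / ((1 - x) * r ^ 2) = 1 := by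
    rw [div_eq_one_iff_eq (by positivity)]
    linear_combination r * hxr - (1 + x) * hMr
  rw [entropyLike_eq_sq_mul_exp hM hr hx, hu, hv]
  simp


/-- for `M > 0`,
`sup_{x ∈ [0,1]} M^{2x} (1+x)^{1+x} / ((2x)^{2x} (1−x)^{1−x}) = (M + √(M²+4))²/4`,
attained at the point `x ∈ (0,1)` with `x² = M²/(M²+4)` (real powers, `0^0 = 1`). -/
theorem sup_entropy_like_function' (M : ℝ) (hM : 0 < M) :
    sSup ((fun x : ℝ =>
          M ^ (2 * x) * (1 + x) ^ (1 + x) / ((2 * x) ^ (2 * x) * (1 - x) ^ (1 - x)))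
        '' Set.Icc 0 1)
        = (M + Real.sqrt (M ^ 2 + 4)) ^ 2 / 4 ∧
      ∀ x ∈ Set.Ioo (0 : ℝ) 1, x ^ 2 = M ^ 2 / (M ^ 2 + 4) →
        M ^ (2 * x) * (1 + x) ^ (1 + x) / ((2 * x) ^ (2 * x) * (1 - x) ^ (1 - x))
          = (M + Real.sqrt (M ^ 2 + 4)) ^ 2 / 4 := by
  set s := Real.sqrt (M ^ 2 + 4) with hs
  have hs2 : s ^ 2 = M ^ 2 + 4 := Real.sq_sqrt (by positivity)
  have hs0 : 0 < s := Real.sqrt_pos.mpr (by positivity)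
  have hMs : M < s := by nlinarith
  have hr : 0 < (M + s) / 2 := by positivity
  have hMr : ((M + s) / 2) ^ 2 = M * ((M + s) / 2) + 1 := by linear_combination hs2 / 4
  rw [show (M + s) ^ 2 / 4 = ((M + s) / 2) ^ 2 by ring]
  refine ⟨IsGreatest.csSup_eq ⟨⟨M / s, ?_, ?_⟩, ?_⟩, ?_⟩
  · exact ⟨by positivity, (div_le_one hs0).mpr hMs.le⟩
  · exact entropyLike_eq_sq hM hr hMr ⟨by positivity, (div_lt_one hs0).mpr hMs⟩
      (by field_simp; ring)
  · rintro _ ⟨x, hx, rfl⟩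
    exact entropyLike_le_sq hM hr hMr hx
  · intro x hx hxM
    have hxs : x = M / s := by
      rw [← hs2, ← div_pow] at hxM
      exact (pow_left_inj₀ hx.1.le (by positivity) two_ne_zero).mp hxM
    exact entropyLike_eq_sq hM hr hMr hx (by rw [hxs]; field_simp; ring)
end

section
/- For all integers k ≥ 1 and l ≥ k+1, binom(l+k−1, k−1) − binom(l+k−1, k−2) = Σ_{a=1}^{k} C_a · ( binom(l+k−1−2a, k−a) − binom(l+k−1−2a, k−a−1) ), where binomial coefficients with negative lower index are interpreted as 0. -/
/-- The ballot number `binom(m + 2k, k) - binom(m + 2k, k - 1)`, the coefficient of `x ^ k` in the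
`(m + 1)`-st power of the Catalan generating function. -/
def ballotNumber (m : ℕ) : ℕ → ℤ
  | 0 => 1
  | k + 1 => (m + 2 * (k + 1)).choose (k + 1) - (m + 2 * (k + 1)).choose k

theorem ballotNumber_zero_right (m : ℕ) : ballotNumber m 0 = 1 := rfl

theorem ballotNumber_succ_right (m k : ℕ) : ballotNumber m (k + 1) =
    (m + 2 * (k + 1)).choose (k + 1) - (m + 2 * (k + 1)).choose k := rfl

theorem ballotNumber_succ_succ (m k : ℕ) :
    ballotNumber (m + 1) (k + 1) = ballotNumber m (k + 1) + ballotNumber (m + 2) k := by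
  rw [ballotNumber_succ_right, ballotNumber_succ_right,
    show m + 1 + 2 * (k + 1) = m + 2 * (k + 1) + 1 by ring, Nat.choose_succ_succ' _ k]
  cases k with
  | zero => simp [ballotNumber_zero_right]
  | succ k =>
    rw [ballotNumber_succ_right, Nat.choose_succ_succ' _ k,
      show m + 2 + 2 * (k + 1) = m + 2 * (k + 1 + 1) by ring]
    push_cast
    ring

theorem ballotNumber_zero_succ (k : ℕ) : ballotNumber 0 (k + 1) = ballotNumber 1 k := by
  rw [ballotNumber_succ_right, show 0 + 2 * (k + 1) = 2 * k + 1 + 1 by ring,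
    Nat.choose_succ_succ' _ k, Nat.choose_symm_half]
  cases k with
  | zero => simp [ballotNumber_zero_right]
  | succ k =>
    rw [ballotNumber_succ_right, Nat.choose_succ_succ' (2 * (k + 1) + 1) k,
      show 1 + 2 * (k + 1) = 2 * (k + 1) + 1 by ring]
    push_cast
    ring

theorem ballotNumber_zero_left (k : ℕ) : ballotNumber 0 k = catalan k := by
  cases k with
  | zero => simp [ballotNumber_zero_right]
  | succ k =>
    have h₁ := succ_mul_catalan_eq_centralBinom (k + 1)
    have h₂ := Nat.choose_succ_right_eq (2 * (k + 1)) k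
    rw [Nat.centralBinom] at h₁
    rw [show 2 * (k + 1) - k = k + 2 by lia] at h₂
    rw [ballotNumber_succ_right, zero_add]
    zify at h₁ h₂
    have h₃ : (k + 2 : ℤ) ≠ 0 := by positivity
    apply mul_left_cancel₀ h₃
    linear_combination h₂ - h₁

theorem sum_antidiagonal_catalan_mul_ballotNumber (k m : ℕ) :
    ∑ p ∈ Finset.HasAntidiagonal.antidiagonal k, (catalan p.1 : ℤ) * ballotNumber m p.2 =
      ballotNumber (m + 1) k := by
  induction k generalizing m with
  | zero => simp [ballotNumber_zero_right]
  | succ k ihk =>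
    induction m with
    | zero =>
      rw [← ballotNumber_zero_succ, ballotNumber_zero_left, catalan_succ']
      simp [ballotNumber_zero_left]
    | succ m ihm =>
      rw [ballotNumber_succ_succ, ← ihm, ← ihk]
      simp only [Finset.Nat.sum_antidiagonal_succ', ballotNumber_succ_succ, mul_add,
        Finset.sum_add_distrib, ballotNumber_zero_right]
      ring


/-- for `k ≥ 1` and `l ≥ k+1`,
`binom(l+k−1, k−1) − binom(l+k−1, k−2)
  = Σ_{a=1}^k C_a·(binom(l+k−1−2a, k−a) − binom(l+k−1−2a, k−a−1))`
(binomials with negative lower index are `0`). -/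
theorem binomial_catalan_convolution_identity (k l : ℕ) (hk : 1 ≤ k)
    (hl : k + 1 ≤ l) :
    (Nat.choose (l + k - 1) (k - 1) : ℤ) -
        (if 2 ≤ k then (Nat.choose (l + k - 1) (k - 2) : ℤ) else 0)
      = ∑ a ∈ Finset.Icc 1 k, (catalan a : ℤ) *
          ((Nat.choose (l + k - 1 - 2 * a) (k - a) : ℤ) -
            (if a + 1 ≤ k then (Nat.choose (l + k - 1 - 2 * a) (k - a - 1) : ℤ) else 0)) := by
  obtain ⟨k, rfl⟩ := Nat.exists_eq_add_of_le' hk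
  obtain ⟨m, rfl⟩ := Nat.exists_eq_add_of_le hl
  rw [show k + 1 + 1 + m + (k + 1) - 1 = m + 2 * (k + 1) by lia]
  have hsum := sum_antidiagonal_catalan_mul_ballotNumber (k + 1) m
  rw [ballotNumber_succ_succ, Finset.Nat.sum_antidiagonal_succ, catalan_zero, Nat.cast_one,
    one_mul, add_right_inj, Finset.Nat.sum_antidiagonal_eq_sum_range_succ
      (fun i j => (catalan (i + 1) : ℤ) * ballotNumber m j)] at hsum
  rw [← Finset.Ico_add_one_right_eq_Icc, Finset.sum_Ico_eq_sum_range]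
  trans ballotNumber (m + 2) k
  · cases k with
    | zero => simp [ballotNumber_zero_right]
    | succ k =>
      rw [ballotNumber_succ_right, show m + 2 + 2 * (k + 1) = m + 2 * (k + 1 + 1) by ring]
      simp
  · rw [← hsum]
    refine Finset.sum_congr rfl fun a ha => ?_
    obtain ⟨c, rfl⟩ := Nat.exists_eq_add_of_le (Nat.lt_succ_iff.mp (Finset.mem_range.mp ha))
    rw [show m + 2 * (a + c + 1) - 2 * (1 + a) = m + 2 * c by lia,
      show a + c + 1 - (1 + a) = c by lia, add_comm 1 a, Nat.add_sub_cancel_left]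
    congr 1
    cases c with
    | zero => simp [ballotNumber_zero_right]
    | succ c =>
      rw [ballotNumber_succ_right, if_pos (by lia), Nat.add_sub_cancel]
end
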